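/- Let s > γ + 1 = ρ + 3/2 > 3/2 and μ, ν ∈ {+, −}. Then there is a constant C_{s,γ} such that for all u ∈ H^s(ℝ) ∩ C_*^ρ(ℝ), ‖Q_{μν}[u_μ, u_ν]‖_{H^γ} ≤ C_{s,γ} ‖u‖_{C_*^ρ} ‖u‖_{H^s}, where u₊ = u and u₋ = conjugate of u. -/

import Mathlib

open MeasureTheory Complex Filter
open scoped ENNReal FourierTransform Real

noncomputable section

/-- Complexification of a real-valued function. -/
def cplx (f : ℝ → ℝ) : ℝ → ℂ := fun x => (f x : ℂ)

/-- `L²`-based Sobolev norm `H^s` on `ℝ`, as an extended nonnegative real. -/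
def HNorm (s : ℝ) (u : ℝ → ℂ) : ℝ≥0∞ :=
  (∫⁻ ξ : ℝ, ENNReal.ofReal ((1 + ξ ^ 2) ^ s) * (‖𝓕 u ξ‖₊ : ℝ≥0∞) ^ 2) ^ (1/2 : ℝ)

/-- A Littlewood–Paley family: a smooth bump supported in the annulus `1/2 ≤ |ξ| ≤ 2`
whose dyadic dilates form a partition of unity away from the origin. -/
structure LPFamily where
  χ : ℝ → ℝ
  smooth : ContDiff ℝ (⊤ : ℕ∞) χ
  supp : ∀ ξ : ℝ, χ ξ ≠ 0 → |ξ| ∈ Set.Icc (1/2 : ℝ) 2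
  hsum : ∀ ξ : ℝ, ξ ≠ 0 → HasSum (fun k : ℤ => χ (ξ / 2 ^ k)) 1

/-- Littlewood–Paley projection `P_k` onto frequencies `|ξ| ≈ 2^k`. -/
def LP (χ : ℝ → ℝ) (k : ℤ) (u : ℝ → ℂ) : ℝ → ℂ :=
  𝓕⁻ (fun ξ => (χ (ξ / 2 ^ k) : ℂ) * 𝓕 u ξ)

/-- Low-frequency Littlewood–Paley projection `P_{≤0}`. -/
def LPlow (χ : ℝ → ℝ) (u : ℝ → ℂ) : ℝ → ℂ :=
  𝓕⁻ (fun ξ => ((1 - ∑' k : ℕ, χ (ξ / 2 ^ (k + 1)) : ℝ) : ℂ) * 𝓕 u ξ)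

/-- Sup-norm, as an extended nonnegative real. -/
def LooNorm (f : ℝ → ℂ) : ℝ≥0∞ := ⨆ x : ℝ, (‖f x‖₊ : ℝ≥0∞)

/-- The Hölder–Zygmund (Besov `B^γ_{∞,∞}`) norm `C_*^γ` (relative to a LP family `χ`). -/
def BesovNorm (χ : ℝ → ℝ) (γ : ℝ) (u : ℝ → ℂ) : ℝ≥0∞ :=
  LooNorm (LPlow χ u) ⊔
    ⨆ k : ℕ, ENNReal.ofReal ((2:ℝ) ^ (γ * ((k:ℝ) + 1))) * LooNorm (LP χ (k + 1) u)

/-- The fractional derivative `|∇|^s`: Fourier multiplier with symbol `|ξ|^s`. -/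
def fracD (s : ℝ) (u : ℝ → ℂ) : ℝ → ℂ :=
  𝓕⁻ (fun ξ => ((|ξ| ^ s : ℝ) : ℂ) * 𝓕 u ξ)

/-- The half-wave propagator `e^{-itΛ}`, `Λ = |∇|^{1/2}`. -/
def halfWave (t : ℝ) (u : ℝ → ℂ) : ℝ → ℂ :=
  𝓕⁻ (fun ξ => Complex.exp (-(t * Real.sqrt |ξ|) * Complex.I) * 𝓕 u ξ)

/-- `Ψ` is harmonic at the point `p` (of class `C²` with vanishing Laplacian). -/
def IsHarmonicAt (Ψ : ℝ × ℝ → ℝ) (p : ℝ × ℝ) : Prop :=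
  ContDiffAt ℝ 2 Ψ p ∧
    fderiv ℝ (fun q => fderiv ℝ Ψ q (1, 0)) p (1, 0)
      + fderiv ℝ (fun q => fderiv ℝ Ψ q (0, 1)) p (0, 1) = 0

/-- `g = G(h)ψ` is the Dirichlet-to-Neumann operator of the domain `{(x,y) : y < h(x)}`
applied to `ψ`: there is a bounded harmonic extension `Ψ` of `ψ` to the domain with
`g = √(1+h'²)·∂_nΨ = ∂_yΨ - h'·∂_xΨ` on the boundary graph. -/
def IsDtN (h ψ g : ℝ → ℝ) : Prop :=
  ∃ Ψ : ℝ × ℝ → ℝ,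
    (∀ p : ℝ × ℝ, p.2 < h p.1 → IsHarmonicAt Ψ p) ∧
    (∃ M : ℝ, ∀ p : ℝ × ℝ, p.2 ≤ h p.1 → |Ψ p| ≤ M) ∧
    ContinuousOn Ψ {p : ℝ × ℝ | p.2 ≤ h p.1} ∧
    (∀ x : ℝ, Ψ (x, h x) = ψ x) ∧
    (∀ x : ℝ, DifferentiableAt ℝ Ψ (x, h x) ∧
      g x = fderiv ℝ Ψ (x, h x) (0, 1) - deriv h x * fderiv ℝ Ψ (x, h x) (1, 0))

/-- `B = B(h)ψ = (G(h)ψ + h'ψ')/(1 + h'²)`, where `g = G(h)ψ`. -/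
def Bfun (h ψ g : ℝ → ℝ) : ℝ → ℝ :=
  fun x => (g x + deriv h x * deriv ψ x) / (1 + (deriv h x) ^ 2)

/-- `V = V(h)ψ = ψ' - h'·B(h)ψ`, where `g = G(h)ψ`. -/
def Vfun (h ψ g : ℝ → ℝ) : ℝ → ℝ :=
  fun x => deriv ψ x - deriv h x * Bfun h ψ g x

/-- An admissible paraproduct cutoff: smooth `φ(ξ₁,ξ₂)`, equal to `1` for
`|ξ₁| ≪ |ξ₂|`, `|ξ₂| ≫ 1` and to `0` for `|ξ₁| ≳ |ξ₂|` or `|ξ₂| ≲ 1`. -/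
structure ParaCutoff where
  φ : ℝ × ℝ → ℝ
  smooth : ContDiff ℝ (⊤ : ℕ∞) φ
  ε₁ : ℝ
  ε₂ : ℝ
  M₁ : ℝ
  M₂ : ℝ
  hε₁ : 0 < ε₁
  hε₁₂ : ε₁ < ε₂
  hM₁ : 0 < M₁
  hM₁₂ : M₁ < M₂
  eq_one : ∀ ξ₁ ξ₂ : ℝ, |ξ₁| ≤ ε₁ * |ξ₂| → M₂ ≤ |ξ₂| → φ (ξ₁, ξ₂) = 1
  eq_zero : ∀ ξ₁ ξ₂ : ℝ, ε₂ * |ξ₂| ≤ |ξ₁| ∨ |ξ₂| ≤ M₁ → φ (ξ₁, ξ₂) = 0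

/-- The paraproduct `T_f g` with cutoff `φ`. -/
def paraprod (φ : ℝ × ℝ → ℝ) (f g : ℝ → ℂ) : ℝ → ℂ :=
  𝓕⁻ (fun ξ => ∫ ξ₁ : ℝ, (φ (ξ₁, ξ - ξ₁) : ℂ) * 𝓕 f ξ₁ * 𝓕 g (ξ - ξ₁))

/-- The good unknown `w = ψ - T_B h`. -/
def wfun (φ : ℝ × ℝ → ℝ) (h ψ g : ℝ → ℝ) : ℝ → ℂ :=
  fun x => (ψ x : ℂ) - paraprod φ (cplx (Bfun h ψ g)) (cplx h) x

/-- `(h, ψ)` solves the gravity water wave system (Zakharov formulation) on `[0,T]`,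
with `g t = G(h(t))ψ(t)` the Dirichlet-to-Neumann term. -/
def IsWWSolution (T : ℝ) (h ψ g : ℝ → ℝ → ℝ) : Prop :=
  ∀ t ∈ Set.Icc (0:ℝ) T,
    IsDtN (h t) (ψ t) (g t) ∧
    ∀ x : ℝ,
      HasDerivAt (fun τ => h τ x) (g t x) t ∧
      HasDerivAt (fun τ => ψ τ x)
        (-(h t x) - (deriv (ψ t) x) ^ 2 / 2
          + (g t x + deriv (h t) x * deriv (ψ t) x) ^ 2
            / (2 * (1 + (deriv (h t) x) ^ 2))) t

/-- `t ↦ f t` belongs to `C([0,T], H^s)`. -/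
def ContInH (s T : ℝ) (f : ℝ → ℝ → ℂ) : Prop :=
  (∀ t ∈ Set.Icc (0:ℝ) T, HNorm s (f t) < ⊤) ∧
  ∀ t ∈ Set.Icc (0:ℝ) T,
    Tendsto (fun τ => HNorm s (fun x => f τ x - f t x))
      (nhdsWithin t (Set.Icc (0:ℝ) T)) (nhds 0)

/-- The phase `Φ_{μν}(ξ₁,ξ₂) = √|ξ₁+ξ₂| - μ√|ξ₁| - ν√|ξ₂|` (`μ, ν ∈ {1,-1}`). -/
def PhiFn (μ ν : ℝ) (ξ₁ ξ₂ : ℝ) : ℝ :=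
  Real.sqrt |ξ₁ + ξ₂| - μ * Real.sqrt |ξ₁| - ν * Real.sqrt |ξ₂|

/-- First basic quadratic symbol of the water wave nonlinearity. -/
def msym₁ (ξ₁ ξ₂ : ℝ) : ℝ :=
  (|ξ₁ + ξ₂| * |ξ₂| - (ξ₁ + ξ₂) * ξ₂) / Real.sqrt |ξ₂|

/-- Second basic quadratic symbol of the water wave nonlinearity. -/
def msym₂ (ξ₁ ξ₂ : ℝ) : ℝ :=
  Real.sqrt |ξ₁ + ξ₂| * (|ξ₁| * |ξ₂| + ξ₁ * ξ₂) / Real.sqrt (|ξ₁| * |ξ₂|)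

/-- A linear combination `a·m₁ + b·m₂` of the two basic quadratic symbols. -/
def msym (a b : ℂ) (ξ₁ ξ₂ : ℝ) : ℂ := a * (msym₁ ξ₁ ξ₂ : ℂ) + b * (msym₂ ξ₁ ξ₂ : ℂ)

/-- The bilinear Fourier multiplier with symbol `m(ξ₁,ξ₂)/(iΦ_{μν}(ξ₁,ξ₂))`. -/
def Qop (μ ν : ℝ) (m : ℝ → ℝ → ℂ) (f g : ℝ → ℂ) : ℝ → ℂ :=
  𝓕⁻ (fun ξ => ∫ ξ₁ : ℝ,
    m ξ₁ (ξ - ξ₁) / (Complex.I * (PhiFn μ ν ξ₁ (ξ - ξ₁) : ℂ)) * 𝓕 f ξ₁ * 𝓕 g (ξ - ξ₁))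

/-- `pick 1 u = u`, `pick (-1) u = conj u`. -/
def pick (μ : ℝ) (u : ℝ → ℂ) : ℝ → ℂ :=
  if μ = 1 then u else fun x => (starRingEnd ℂ) (u x)

/-- The complex unknown `u = h + i|∇|^{1/2}ψ`. -/
def uOf (h ψ : ℝ → ℝ) : ℝ → ℂ :=
  fun x => (h x : ℂ) + Complex.I * fracD (1/2) (cplx ψ) x

/-- The full nonlinearity `N = (G(h)-|∇|)ψ + (i/2)|∇|^{1/2}((1+h'²)B² - ψ'²)`. -/
def Nfun (h ψ g : ℝ → ℝ) : ℝ → ℂ := fun x =>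
  ((g x : ℂ) - fracD 1 (cplx ψ) x)
  + (Complex.I / 2) * fracD (1/2)
      (fun y => (((1 + (deriv h y) ^ 2) * (Bfun h ψ g y) ^ 2 - (deriv ψ y) ^ 2 : ℝ) : ℂ)) x

/-- The cubic remainder `B₃ = B - |∇|ψ + |∇|(h|∇|ψ) + hψ''`. -/
def B3fun (h ψ g : ℝ → ℝ) : ℝ → ℂ := fun x =>
  (Bfun h ψ g x : ℂ) - fracD 1 (cplx ψ) x
  + fracD 1 (fun y => (h y : ℂ) * fracD 1 (cplx ψ) y) x
  + (h x : ℂ) * ((deriv (deriv ψ) x : ℝ) : ℂ)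

/-- The cubic part `N₃ = B₃ + h'²B + (i/2)|∇|^{1/2}(B² - (|∇|ψ)² + h'²B²)`. -/
def N3fun (h ψ g : ℝ → ℝ) : ℝ → ℂ := fun x =>
  B3fun h ψ g x + (((deriv h x) ^ 2 * Bfun h ψ g x : ℝ) : ℂ)
  + (Complex.I / 2) * fracD (1/2)
      (fun y => ((Bfun h ψ g y : ℂ)) ^ 2 - (fracD 1 (cplx ψ) y) ^ 2
        + (((deriv h y) ^ 2 : ℝ) : ℂ) * ((Bfun h ψ g y : ℂ)) ^ 2) x

/-- `L⁴` norm in time on `[0,T]` of the `C_*^ρ` norm. -/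
def L4Besov (χ : ℝ → ℝ) (ρ T : ℝ) (u : ℝ → ℝ → ℂ) : ℝ≥0∞ :=
  (∫⁻ t in Set.Icc (0:ℝ) T, (BesovNorm χ ρ (u t)) ^ 4) ^ (1/4 : ℝ)

/-- The energy `E_s(t) = ‖h(t)‖_{H^s} + ‖|∇|^{1/2}w(t)‖_{H^s}`. -/
def Es (φ : ℝ × ℝ → ℝ) (s : ℝ) (h ψ g : ℝ → ℝ → ℝ) (t : ℝ) : ℝ≥0∞ :=
  HNorm s (cplx (h t)) + HNorm s (fracD (1/2) (wfun φ (h t) (ψ t) (g t)))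

/-- `F_s = sup_{t ∈ [0,T]} ‖u(t)‖_{H^s}`. -/
def FsSup (s T : ℝ) (u : ℝ → ℝ → ℂ) : ℝ≥0∞ :=
  ⨆ t ∈ Set.Icc (0:ℝ) T, HNorm s (u t)

/-- The cubic bulk bilinear term `C_{μν} = Q_{μν}[u_μ, N_ν] + Q_{μν}[N_μ, u_ν]`. -/
def Cop (μ ν : ℝ) (m : ℝ → ℝ → ℂ) (u N : ℝ → ℂ) : ℝ → ℂ := fun x =>
  Qop μ ν m (pick μ u) (pick ν N) x + Qop μ ν m (pick μ N) (pick ν u) x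

open scoped Convolution NNReal SchwartzMap

/-- A locally integrable function that integrates to zero against every Schwartz function
vanishes almost everywhere. -/
theorem ae_eq_of_integral_schwartz_mul {f g : ℝ → ℂ} (hf : LocallyIntegrable f)
    (hg : LocallyIntegrable g)
    (h : ∀ φ : 𝓢(ℝ, ℂ), ∫ x, φ x * f x = ∫ x, φ x * g x) : f =ᵐ[volume] g := by
  refine ae_eq_of_integral_contDiff_smul_eq hf hg fun φ hφ hc => ?_
  have hφ' : ContDiff ℝ (⊤ : ℕ∞) (fun x => (φ x : ℂ)) := Complex.ofRealCLM.contDiff.comp hφ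
  have hc' : HasCompactSupport (fun x => (φ x : ℂ)) := hc.comp_left (g := fun r : ℝ => (r : ℂ)) rfl
  have := h (hc'.toSchwartzMap hφ')
  simpa using this

theorem integral_fourier_mul {f g : ℝ → ℂ} (hf : Integrable f) (hg : Integrable g) :
    ∫ x, 𝓕 f x * g x = ∫ x, f x * 𝓕 g x := by
  have := VectorFourier.integral_fourierIntegral_smul_eq_flip (L := innerₗ ℝ)
    Real.continuous_fourierChar continuous_inner hf hg
  rw [flip_innerₗ] at this
  exact this

theorem integral_fourierInv_mul {f g : ℝ → ℂ} (hf : Integrable f) (hg : Integrable g) :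
    ∫ x, 𝓕⁻ f x * g x = ∫ x, f x * 𝓕⁻ g x := by
  have h := integral_fourier_mul (f := f) (g := fun x => g (-x)) hf hg.comp_neg
  rw [← integral_neg_eq_self (fun x => 𝓕⁻ f x * g x)]
  simp only [Real.fourierInv_eq_fourier_neg, neg_neg] at *
  rw [h]
  refine integral_congr_ae (Eventually.of_forall fun x => ?_)
  simp only
  rw [← Real.fourierInv_eq_fourier_comp_neg, Real.fourierInv_eq_fourier_neg]

theorem continuous_fourierInv {f : ℝ → ℂ} (hf : Integrable f) : Continuous (𝓕⁻ f) := by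
  have : 𝓕⁻ f = fun x => 𝓕 f (-x) := by ext x; rw [Real.fourierInv_eq_fourier_neg]
  rw [this]
  exact (VectorFourier.fourierIntegral_continuous Real.continuous_fourierChar
    (by exact continuous_inner) hf).comp continuous_neg

/-- **Plancherel's theorem** for functions in `L¹ ∩ L²`. -/
theorem eLpNorm_fourierInv {W : ℝ → ℂ} (h1 : Integrable W) (h2 : MemLp W 2) :
    eLpNorm (𝓕⁻ W) 2 = eLpNorm W 2 := by
  set F : Lp ℂ 2 (volume : Measure ℝ) := h2.toLp W
  have key : (𝓕⁻ F : Lp ℂ 2 (volume : Measure ℝ)) =ᵐ[volume] 𝓕⁻ W := by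
    refine ae_eq_of_integral_schwartz_mul ((Lp.memLp _).locallyIntegrable (by norm_num))
      (continuous_fourierInv h1).locallyIntegrable fun φ => ?_
    have e := congrArg (fun T => T φ) (Lp.fourierInv_toTemperedDistribution_eq F)
    simp only [TemperedDistribution.fourierInv_apply, Lp.toTemperedDistribution_apply,
      smul_eq_mul] at e
    rw [← e]
    have e2 := integral_fourierInv_mul φ.integrable h1
    rw [← e2]
    refine integral_congr_ae ?_
    filter_upwards [h2.coeFn_toLp] with x hx
    rw [hx, SchwartzMap.fourierInv_coe]
  rw [← eLpNorm_congr_ae key, ← eLpNorm_congr_ae h2.coeFn_toLp]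
  have : ‖(𝓕⁻ F : Lp ℂ 2 (volume : Measure ℝ))‖ = ‖F‖ :=
    (Lp.fourierTransformₗᵢ ℝ ℂ).symm.norm_map F
  rw [Lp.norm_def, Lp.norm_def] at this
  exact (ENNReal.toReal_eq_toReal_iff' (Lp.eLpNorm_ne_top _) (Lp.eLpNorm_ne_top _)).1 this

/-- Fourier inversion in `L¹`, without continuity. -/
theorem fourier_fourierInv_ae {W : ℝ → ℂ} (h1 : Integrable W) (h2 : Integrable (𝓕⁻ W)) :
    𝓕 (𝓕⁻ W) =ᵐ[volume] W := by
  have hc : Continuous (𝓕 (𝓕⁻ W)) :=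
    VectorFourier.fourierIntegral_continuous Real.continuous_fourierChar
      (by exact continuous_inner) h2
  refine ae_eq_of_integral_schwartz_mul hc.locallyIntegrable h1.locallyIntegrable fun φ => ?_
  rw [← integral_fourier_mul φ.integrable h2]
  have hφ : Integrable (𝓕 (φ : ℝ → ℂ)) := by
    rw [← SchwartzMap.fourier_coe]; exact (𝓕 φ).integrable
  have a2 := integral_fourierInv_mul hφ h1
  rw [← a2, φ.continuous.fourierInv_fourier_eq φ.integrable hφ]

/-- Convolution of complex-valued functions on the line. -/
def conv (V W : ℝ → ℂ) : ℝ → ℂ := V ⋆[ContinuousLinearMap.mul ℂ ℂ] W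

theorem conv_apply (V W : ℝ → ℂ) (x : ℝ) : conv V W x = ∫ t, V t * W (x - t) := rfl

/-- Integrable bounded functions. -/
structure IntBdd (W : ℝ → ℂ) : Prop where
  integrable : Integrable W
  bdd : ∃ C : ℝ, ∀ x, ‖W x‖ ≤ C

theorem IntBdd.memLp {W : ℝ → ℂ} (h : IntBdd W) : MemLp W 2 := by
  obtain ⟨C, hC⟩ := h.bdd
  rw [memLp_two_iff_integrable_sq_norm h.integrable.1]
  refine (h.integrable.norm.const_mul C).mono' (h.integrable.1.norm.pow 2)
    (Eventually.of_forall fun x => ?_)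
  rw [Real.norm_of_nonneg (by positivity), sq]
  gcongr
  exact hC x

theorem IntBdd.conv {V W : ℝ → ℂ} (hV : IntBdd V) (hW : IntBdd W) : IntBdd (conv V W) := by
  refine ⟨hV.integrable.integrable_convolution _ hW.integrable, ?_⟩
  obtain ⟨C, hC⟩ := hW.bdd
  refine ⟨∫ t, ‖V t‖ * C, fun x => ?_⟩
  rw [conv_apply]
  refine norm_integral_le_of_norm_le (hV.integrable.norm.mul_const C)
    (Eventually.of_forall fun t => ?_)
  rw [norm_mul]
  gcongr
  exact hC _

theorem IntBdd.indicator {W : ℝ → ℂ} (h : IntBdd W) {s : Set ℝ} (hs : MeasurableSet s) :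
    IntBdd (s.indicator W) := by
  refine ⟨h.integrable.indicator hs, ?_⟩
  obtain ⟨C, hC⟩ := h.bdd
  exact ⟨C, fun x => (norm_indicator_le_norm_self _ _).trans (hC x)⟩

theorem IntBdd.neg {W : ℝ → ℂ} (h : IntBdd W) : IntBdd (fun x => -W x) :=
  ⟨h.integrable.neg, by simpa using h.bdd⟩

theorem fourierInv_conv {V W : ℝ → ℂ} (hV : Integrable V) (hW : Integrable W) (x : ℝ) :
    𝓕⁻ (conv V W) x = 𝓕⁻ V x * 𝓕⁻ W x := by
  simp only [Real.fourierInv_eq_fourier_neg]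
  exact Real.fourier_mul_convolution_eq hV hW _

theorem fourierInv_add' {V W : ℝ → ℂ} (hV : Integrable V) (hW : Integrable W) (x : ℝ) :
    𝓕⁻ (fun y => V y + W y) x = 𝓕⁻ V x + 𝓕⁻ W x := by
  simp only [Real.fourierInv_eq_fourier_neg, Real.fourier_eq]
  rw [← integral_add]
  · simp only [smul_add]
  · exact (Real.fourierIntegral_convergent_iff (-x)).2 hV
  · exact (Real.fourierIntegral_convergent_iff (-x)).2 hW

theorem fourierInv_neg' (V : ℝ → ℂ) (x : ℝ) :
    𝓕⁻ (fun y => -V y) x = -𝓕⁻ V x := by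
  simp only [Real.fourierInv_eq, smul_neg, integral_neg]

theorem conv_eq_zero {V W : ℝ → ℂ} {s : Set ℝ} (hs : ∀ x ∈ s, ∀ y ∈ s, x + y ∈ s)
    (hV : ∀ x ∉ s, V x = 0) (hW : ∀ x ∉ s, W x = 0) : ∀ x ∉ s, conv V W x = 0 := by
  intro x hx
  rw [conv_apply, ← integral_zero ℝ ℂ]
  refine integral_congr_ae (Eventually.of_forall fun t => ?_)
  by_cases h1 : t ∈ s
  · by_cases h2 : x - t ∈ s
    · exact absurd (by simpa using hs _ h1 _ h2) hx
    · simp [hW _ h2]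
  · simp [hV _ h1]

theorem exists_fourierInv_eq_pow {V : ℝ → ℂ} (hV : IntBdd V) {s : Set ℝ}
    (hs : ∀ x ∈ s, ∀ y ∈ s, x + y ∈ s) (hVs : ∀ x ∉ s, V x = 0) (m : ℕ) :
    ∃ W, IntBdd W ∧ (∀ x ∉ s, W x = 0) ∧ ∀ x, 𝓕⁻ W x = (𝓕⁻ V x) ^ (m + 1) := by
  induction m with
  | zero => exact ⟨V, hV, hVs, by simp⟩
  | succ m ih =>
    obtain ⟨W, hW, hWs, hWp⟩ := ih
    refine ⟨conv V W, hV.conv hW, conv_eq_zero hs hVs hWs, fun x => ?_⟩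
    rw [fourierInv_conv hV.integrable hW.integrable, hWp, pow_succ' _ (m + 1)]

theorem eLpNorm_pow_le_sub {V₁ V₂ : ℝ → ℂ} (h₁ : IntBdd V₁) (h₂ : IntBdd V₂) {s : Set ℝ}
    (hs : ∀ x ∈ s, ∀ y ∈ s, x + y ∈ s) (hs' : ∀ x ∈ sᶜ, ∀ y ∈ sᶜ, x + y ∈ sᶜ)
    (hV₁ : ∀ x ∉ s, V₁ x = 0) (hV₂ : ∀ x ∉ sᶜ, V₂ x = 0) (m : ℕ) :
    eLpNorm (fun x => (𝓕⁻ V₁ x) ^ (m + 1)) 2 ≤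
      eLpNorm (fun x => (𝓕⁻ V₁ x) ^ (m + 1) - (𝓕⁻ V₂ x) ^ (m + 1)) 2 := by
  obtain ⟨W₁, i₁, z₁, e₁⟩ := exists_fourierInv_eq_pow h₁ hs hV₁ m
  obtain ⟨W₂, i₂, z₂, e₂⟩ := exists_fourierInv_eq_pow h₂ hs' hV₂ m
  have i₃ : Integrable (fun x => W₁ x + -W₂ x) := i₁.integrable.add i₂.neg.integrable
  have m₃ : MemLp (fun x => W₁ x + -W₂ x) 2 := i₁.memLp.add i₂.neg.memLp
  have e₃ : (fun x => (𝓕⁻ V₁ x) ^ (m + 1) - (𝓕⁻ V₂ x) ^ (m + 1)) =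
      𝓕⁻ (fun x => W₁ x + -W₂ x) := by
    ext x
    rw [fourierInv_add' i₁.integrable i₂.neg.integrable, fourierInv_neg', e₁, e₂, sub_eq_add_neg]
  have e₄ : (fun x => (𝓕⁻ V₁ x) ^ (m + 1)) = 𝓕⁻ W₁ := by ext x; rw [e₁]
  rw [e₃, e₄, eLpNorm_fourierInv i₁.integrable i₁.memLp, eLpNorm_fourierInv i₃ m₃]
  refine eLpNorm_mono fun x => ?_
  by_cases hx : x ∈ s
  · simp [z₂ x (by simpa using hx)]
  · simp [z₁ x hx]

theorem norm_pow_sub_pow_le (f v : ℂ) (m : ℕ) :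
    ‖f ^ (m + 1) - (f - v) ^ (m + 1)‖ ≤
      (m + 1) * 2 ^ m * (‖v‖ * ‖f‖ ^ m + ‖v‖ ^ (m + 1)) := by
  have h1 : ‖f - v‖ ≤ ‖f‖ + ‖v‖ := norm_sub_le _ _
  have h2 : ‖f‖ ≤ ‖f‖ + ‖v‖ := le_add_of_nonneg_right (norm_nonneg _)
  rw [← (Commute.all f (f - v)).mul_geom_sum₂, sub_sub_cancel, norm_mul]
  have h3 : ‖∑ i ∈ Finset.range (m + 1), f ^ i * (f - v) ^ (m + 1 - 1 - i)‖ ≤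
      (m + 1) * (‖f‖ + ‖v‖) ^ m := by
    refine (norm_sum_le _ _).trans ?_
    have : ∀ i ∈ Finset.range (m + 1), ‖f ^ i * (f - v) ^ (m + 1 - 1 - i)‖ ≤
        (‖f‖ + ‖v‖) ^ m := by
      intro i hi
      have hi' : i + (m + 1 - 1 - i) = m := by have := Finset.mem_range.1 hi; omega
      conv_rhs => rw [← hi', pow_add]
      rw [norm_mul, norm_pow, norm_pow]
      gcongr
    refine (Finset.sum_le_sum this).trans ?_
    simp
  have h4 : (‖f‖ + ‖v‖) ^ m ≤ 2 ^ m * (‖f‖ ^ m + ‖v‖ ^ m) := by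
    refine (add_pow_le (norm_nonneg _) (norm_nonneg _) m).trans ?_
    gcongr
    · norm_num
    · omega
  calc _ ≤ ‖v‖ * ((m + 1) * (2 ^ m * (‖f‖ ^ m + ‖v‖ ^ m))) := by gcongr; exact h3.trans (by gcongr)
    _ = _ := by ring

/-- The projection onto the frequencies in a half-line `s` maps bounded functions in `L²` to
functions all of whose powers are in `L²`. -/
theorem exists_eLpNorm_pow_le (m : ℕ) : ∃ C : ℝ≥0, ∀ (V : ℝ → ℂ) (s : Set ℝ) (c : ℝ≥0),
    IntBdd V → MeasurableSet s → (∀ x ∈ s, ∀ y ∈ s, x + y ∈ s) →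
    (∀ x ∈ sᶜ, ∀ y ∈ sᶜ, x + y ∈ sᶜ) → (∀ x, ‖𝓕⁻ V x‖ ≤ c) →
    eLpNorm (fun x => (𝓕⁻ (s.indicator V) x) ^ (m + 1)) 2 ≤ C * c ^ m * eLpNorm V 2 := by
  induction m with
  | zero =>
    refine ⟨1, fun V s c hV hs _ _ _ => ?_⟩
    have := eLpNorm_fourierInv (hV.indicator hs).integrable (hV.indicator hs).memLp
    simp only [zero_add, pow_one, ENNReal.coe_one, pow_zero, one_mul]
    exact this.le.trans (eLpNorm_indicator_le _)
  | succ m ih =>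
    obtain ⟨C, hC⟩ := ih
    refine ⟨(m + 2) * 2 ^ (m + 1) * (C + 1), fun V s c hV hs ha ha' hc => ?_⟩
    have i₁ := hV.indicator hs
    have i₂ := (hV.indicator hs.compl).neg
    have hv : ∀ x, 𝓕⁻ (fun y => -(sᶜ.indicator V y)) x =
        𝓕⁻ (s.indicator V) x - 𝓕⁻ V x := by
      intro x
      have e : V = fun y => s.indicator V y + sᶜ.indicator V y :=
        (Set.indicator_self_add_compl s V).symm
      have : 𝓕⁻ V x = 𝓕⁻ (s.indicator V) x + 𝓕⁻ (sᶜ.indicator V) x := by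
        rw [← fourierInv_add' i₁.integrable (hV.indicator hs.compl).integrable]
        exact congrArg (fun h : ℝ → ℂ => 𝓕⁻ h x) e
      rw [fourierInv_neg', this]
      ring
    have key := eLpNorm_pow_le_sub i₁ i₂ ha ha' (fun x hx => by simp [hx])
      (fun x hx => by simp only [Set.indicator_of_notMem hx, neg_zero]) (m + 1)
    simp only [hv] at key
    refine key.trans ?_
    have cont₁ := continuous_fourierInv i₁.integrable
    have cont₂ := continuous_fourierInv hV.integrable
    set f := 𝓕⁻ (s.indicator V)
    set v := 𝓕⁻ V
    have hmono : eLpNorm (fun x => f x ^ (m + 1 + 1) - (f x - v x) ^ (m + 1 + 1)) 2 ≤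
        eLpNorm (((((m + 2) * 2 ^ (m + 1) : ℝ≥0) : ℝ)) • fun x =>
          ((c : ℝ) * ‖f x ^ (m + 1)‖ + (c : ℝ) ^ (m + 1) * ‖v x‖)) 2 := by
      refine eLpNorm_mono_real fun x => (norm_pow_sub_pow_le (f x) (v x) (m + 1)).trans ?_
      simp only [Pi.smul_apply, smul_eq_mul]
      push_cast
      rw [show ((m : ℝ) + 1 + 1) = m + 2 by ring, pow_succ ‖v x‖ (m + 1), norm_pow]
      gcongr
      · exact hc x
      · exact hc x
    refine hmono.trans ?_
    rw [eLpNorm_const_smul]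
    have h1 : eLpNorm (fun x => (c : ℝ) * ‖f x ^ (m + 1)‖ + (c : ℝ) ^ (m + 1) * ‖v x‖) 2 ≤
        c * (C * c ^ m * eLpNorm V 2) + c ^ (m + 1) * eLpNorm V 2 := by
      refine (eLpNorm_add_le (by fun_prop) (by fun_prop) (by norm_num)).trans ?_
      refine add_le_add ?_ ?_
      · have := eLpNorm_const_smul (c : ℝ) (fun x => ‖f x ^ (m + 1)‖) 2 (volume : Measure ℝ)
        refine this.le.trans ?_
        rw [eLpNorm_norm]
        gcongr
        · simp
        · exact hC V s c hV hs ha ha' hc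
      · have := eLpNorm_const_smul ((c : ℝ) ^ (m + 1)) (fun x => ‖v x‖) 2 (volume : Measure ℝ)
        refine this.le.trans ?_
        rw [eLpNorm_norm, eLpNorm_fourierInv hV.integrable hV.memLp]
        simp [enorm_pow]
    refine (mul_le_mul_right h1 _).trans (le_of_eq ?_)
    simp only [Real.enorm_eq_ofReal NNReal.zero_le_coe, ENNReal.ofReal_coe_nnreal]
    push_cast
    ring

/-- Measurable sets which, together with their complement, are closed under addition. -/
structure IsHalfLine (s : Set ℝ) : Prop where
  measurableSet : MeasurableSet s
  add : ∀ x ∈ s, ∀ y ∈ s, x + y ∈ s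
  add_compl : ∀ x ∈ sᶜ, ∀ y ∈ sᶜ, x + y ∈ sᶜ

theorem isHalfLine_Ioi : IsHalfLine (Set.Ioi 0) :=
  ⟨measurableSet_Ioi, fun x hx y hy => by
    simp only [Set.mem_Ioi] at *; linarith, fun x hx y hy => by
    simp only [Set.mem_compl_iff, Set.mem_Ioi, not_lt] at *; linarith⟩

theorem isHalfLine_Iio : IsHalfLine (Set.Iio 0) :=
  ⟨measurableSet_Iio, fun x hx y hy => by
    simp only [Set.mem_Iio] at *; linarith, fun x hx y hy => by
    simp only [Set.mem_compl_iff, Set.mem_Iio, not_lt] at *; linarith⟩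

theorem eLpNorm_two_sq (f : ℝ → ℂ) : eLpNorm f 2 ^ 2 = ∫⁻ x, ‖f x‖ₑ ^ 2 := by
  have := eLpNorm_nnreal_pow_eq_lintegral (f := f) (μ := volume) (p := 2) (by norm_num)
  norm_num at this
  exact_mod_cast this

theorem eLpNorm_mul_le_interp {a b : ℝ → ℂ} (ha : Continuous a) (hb : Continuous b) (m : ℕ)
    {θ : ℝ} (hθ : θ * (m + 2) = 1) :
    eLpNorm (fun x => a x * b x) 2 ≤ eLpNorm b 2 ^ (1 - 2 * θ) *
      (eLpNorm (fun x => a x ^ (m + 1 + 1)) 2 ^ θ * eLpNorm (fun x => b x ^ (1 + 1)) 2 ^ θ) := by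
  have hθ0 : 0 < θ := by
    by_contra h
    nlinarith [mul_nonneg (neg_nonneg.2 (not_lt.1 h)) (by positivity : (0 : ℝ) ≤ m + 2)]
  have hθ1 : 0 ≤ 1 - 2 * θ := by nlinarith [(Nat.cast_nonneg m : (0 : ℝ) ≤ m)]
  have H := ENNReal.lintegral_prod_norm_pow_le (μ := (volume : Measure ℝ)) (s := Finset.univ)
    (f := ![fun x => ‖b x‖ₑ ^ 2, fun x => ‖a x ^ (m + 1 + 1)‖ₑ ^ 2, fun x => ‖b x ^ (1 + 1)‖ₑ ^ 2])
    (p := ![1 - 2 * θ, θ, θ])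
    (by intro i _; fin_cases i <;> simp <;> fun_prop)
    (by simp [Fin.sum_univ_three]; ring)
    (by intro i _; fin_cases i <;> simp [hθ0.le]; linarith)
  simp only [Fin.prod_univ_three, Matrix.cons_val_zero, Matrix.cons_val_one,
    Matrix.cons_val] at H
  simp only [← eLpNorm_two_sq] at H
  have e : ∀ x, (‖b x‖ₑ ^ 2) ^ (1 - 2 * θ) * (‖a x ^ (m + 1 + 1)‖ₑ ^ 2) ^ θ *
      (‖b x ^ (1 + 1)‖ₑ ^ 2) ^ θ = ‖a x * b x‖ₑ ^ 2 := by
    intro x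
    simp only [enorm_pow, ← ENNReal.rpow_natCast, ← ENNReal.rpow_mul, enorm_mul]
    rw [ENNReal.mul_rpow_of_nonneg _ _ (by positivity), mul_right_comm,
      ← ENNReal.rpow_add_of_nonneg _ _ (by positivity) (by positivity), mul_comm]
    congr 2
    · push_cast; linear_combination 2 * hθ
    · push_cast; ring
  simp only [e] at H
  rw [← eLpNorm_two_sq] at H
  have e2 : ∀ (y : ℝ≥0∞) (t : ℝ), (y ^ 2) ^ t = (y ^ t) ^ 2 := by
    intro y t
    rw [← ENNReal.rpow_natCast, ← ENNReal.rpow_natCast, ← ENNReal.rpow_mul, ← ENNReal.rpow_mul,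
      mul_comm]
  rw [e2, e2, e2, ← mul_pow, ← mul_pow, mul_assoc] at H
  exact (ENNReal.pow_le_pow_left_iff (by norm_num)).1 H

theorem exists_eLpNorm_conv_le (m : ℕ) {θ : ℝ} (hθ : θ * (m + 2) = 1) :
    ∃ C : ℝ≥0, ∀ (A B : ℝ → ℂ) (s t : Set ℝ) (w₁ w₂ M S r : ℝ≥0),
    IntBdd A → IntBdd B → IsHalfLine s → IsHalfLine t →
    (∀ x, ‖𝓕⁻ A x‖ ≤ (w₁ * M : ℝ≥0)) → (∀ x, ‖𝓕⁻ B x‖ ≤ (w₂ * M : ℝ≥0)) →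
    eLpNorm A 2 ≤ (w₁ * S : ℝ≥0) → eLpNorm B 2 ≤ (w₂ * (r * S) : ℝ≥0) →
    eLpNorm (conv (s.indicator A) (t.indicator B)) 2 ≤
      (C * (w₁ * w₂ * M * S * r ^ (1 - θ)) : ℝ≥0) := by
  have hθ0 : 0 < θ := by
    by_contra h
    nlinarith [mul_nonneg (neg_nonneg.2 (not_lt.1 h)) (by positivity : (0 : ℝ) ≤ m + 2)]
  have hθ1 : 0 ≤ 1 - 2 * θ := by nlinarith [(Nat.cast_nonneg m : (0 : ℝ) ≤ m)]
  obtain ⟨C₁, h₁⟩ := exists_eLpNorm_pow_le (m + 1)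
  obtain ⟨C₂, h₂⟩ := exists_eLpNorm_pow_le 1
  refine ⟨C₁ ^ θ * C₂ ^ θ, fun A B s t w₁ w₂ M S r hA hB hs ht hA1 hB1 hA2 hB2 => ?_⟩
  have iA := hA.indicator hs.measurableSet
  have iB := hB.indicator ht.measurableSet
  have iC := iA.conv iB
  rw [← eLpNorm_fourierInv iC.integrable iC.memLp]
  have e : 𝓕⁻ (conv (s.indicator A) (t.indicator B)) =
      fun x => 𝓕⁻ (s.indicator A) x * 𝓕⁻ (t.indicator B) x := by
    ext x; exact fourierInv_conv iA.integrable iB.integrable x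
  rw [e]
  refine (eLpNorm_mul_le_interp (continuous_fourierInv iA.integrable)
    (continuous_fourierInv iB.integrable) m hθ).trans ?_
  have k₀ : eLpNorm (𝓕⁻ (t.indicator B)) 2 ≤ (w₂ * (r * S) : ℝ≥0) := by
    rw [eLpNorm_fourierInv iB.integrable iB.memLp]
    exact (eLpNorm_indicator_le _).trans hB2
  have k₁ := (h₁ A s _ hA hs.1 hs.2 hs.3 hA1).trans (mul_le_mul_right hA2 _)
  have k₂ := (h₂ B t _ hB ht.1 ht.2 ht.3 hB1).trans (mul_le_mul_right hB2 _)
  have k₁' : eLpNorm (fun x => (𝓕⁻ (s.indicator A) x) ^ (m + 1 + 1)) 2 ≤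
      (C₁ * (w₁ ^ (m + 2) * M ^ (m + 1) * S) : ℝ≥0) := by
    refine k₁.trans (le_of_eq ?_); push_cast; ring
  have k₂' : eLpNorm (fun x => (𝓕⁻ (t.indicator B) x) ^ (1 + 1)) 2 ≤
      (C₂ * (w₂ ^ 2 * M * r * S) : ℝ≥0) := by
    refine k₂.trans (le_of_eq ?_); push_cast; ring
  refine (mul_le_mul' (ENNReal.rpow_le_rpow k₀ hθ1) (mul_le_mul' (ENNReal.rpow_le_rpow k₁' hθ0.le)
    (ENNReal.rpow_le_rpow k₂' hθ0.le))).trans (le_of_eq ?_)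
  rw [← ENNReal.coe_rpow_of_nonneg _ hθ1, ← ENNReal.coe_rpow_of_nonneg _ hθ0.le,
    ← ENNReal.coe_rpow_of_nonneg _ hθ0.le, ← ENNReal.coe_mul, ← ENNReal.coe_mul, ENNReal.coe_inj]
  simp only [NNReal.mul_rpow, ← NNReal.rpow_natCast, ← NNReal.rpow_mul]
  have x₁ : ((m + 2 : ℕ) : ℝ) * θ = 1 := by push_cast; linarith
  have x₂ : ((m + 1 : ℕ) : ℝ) * θ = 1 - θ := by push_cast; linarith
  have x₃ : ((2 : ℕ) : ℝ) * θ = 2 * θ := by norm_num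
  rw [x₁, x₂, x₃]
  have y : ∀ z : ℝ≥0, z ^ (1 - 2 * θ) * z ^ (2 * θ) = z := by
    intro z; rw [← NNReal.rpow_add_of_nonneg _ hθ1 (by positivity)]; simp
  have y' : ∀ z : ℝ≥0, z ^ (1 - 2 * θ) * z ^ θ = z ^ (1 - θ) := by
    intro z; rw [← NNReal.rpow_add_of_nonneg _ hθ1 hθ0.le]; congr 1; ring
  have y'' : ∀ z : ℝ≥0, z ^ (1 - θ) * z ^ θ = z := by
    intro z; rw [← NNReal.rpow_add_of_nonneg _ (by linarith) hθ0.le]; simp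
  calc _ = C₁ ^ θ * C₂ ^ θ * (w₁ ^ (1 : ℝ) * (w₂ ^ (1 - 2 * θ) * w₂ ^ (2 * θ)) *
        (M ^ (1 - θ) * M ^ θ) * ((S ^ (1 - 2 * θ) * S ^ θ) * S ^ θ) *
        (r ^ (1 - 2 * θ) * r ^ θ)) := by ring
    _ = _ := by rw [y, y', y', y'', y'', NNReal.rpow_one]

theorem norm_fourierInv_dilate_mul_le (θ : 𝓢(ℝ, ℂ)) {V : ℝ → ℂ} (hV : Integrable V) {M : ℝ}
    (hM : ∀ x, ‖𝓕⁻ V x‖ ≤ M) {l : ℝ} (hl : 0 < l) (x : ℝ) :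
    ‖𝓕⁻ (fun ξ => θ (ξ / l) * V ξ) x‖ ≤ (∫ y, ‖(𝓕⁻ θ : 𝓢(ℝ, ℂ)) y‖) * M := by
  set K : 𝓢(ℝ, ℂ) := 𝓕⁻ θ with hK
  set f : ℝ → ℂ := fun y => (l : ℂ) * K (l * y) with hf
  set g : ℝ → ℂ := fun ξ => (𝐞 (ξ * x) : Circle) • V ξ with hg
  have hfi : Integrable f := (K.integrable.comp_mul_left' hl.ne').const_mul _
  have hgi : Integrable g := by
    have := (Real.fourierIntegral_convergent_iff (f := V) (μ := volume) (-x)).2 hV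
    simpa [hg, mul_comm] using this
  have hFf : ∀ ξ, 𝓕 f ξ = θ (ξ / l) := by
    intro ξ
    have h1 : 𝓕 (K : ℝ → ℂ) (ξ / l) = θ (ξ / l) := by
      rw [← SchwartzMap.fourier_coe, hK]
      simp
    rw [← h1, Real.fourier_eq, Real.fourier_eq]
    have h2 := Measure.integral_comp_mul_left
      (fun z => (𝐞 (-(inner ℝ z (ξ / l))) : Circle) • K z) l
    rw [abs_of_pos (inv_pos.2 hl)] at h2
    have h3 : (∫ v, (𝐞 (-(inner ℝ v (ξ / l))) : Circle) • K v) = (l : ℂ) *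
        ∫ x, (𝐞 (-(inner ℝ (l * x) (ξ / l))) : Circle) • K (l * x) := by
      rw [h2, Complex.real_smul, ← mul_assoc]
      push_cast
      rw [mul_inv_cancel₀ (by exact_mod_cast hl.ne'), one_mul]
    rw [h3, ← integral_const_mul]
    refine integral_congr_ae (Eventually.of_forall fun y => ?_)
    have : inner ℝ (l * y) (ξ / l) = inner ℝ y ξ := by
      simp only [RCLike.inner_apply, conj_trivial]
      field_simp
    simp only [this, hf, Circle.smul_def, smul_eq_mul]
    ring
  have hFg : ∀ y, 𝓕 g y = 𝓕⁻ V (x - y) := by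
    intro y
    rw [Real.fourier_eq, Real.fourierInv_eq]
    refine integral_congr_ae (Eventually.of_forall fun ξ => ?_)
    simp only [hg, smul_smul, RCLike.inner_apply, conj_trivial]
    rw [← AddChar.map_add_eq_mul]
    congr 2
    ring
  have e : 𝓕⁻ (fun ξ => θ (ξ / l) * V ξ) x = ∫ y, f y * 𝓕⁻ V (x - y) := by
    simp only [← hFg]
    rw [← integral_fourier_mul hfi hgi, Real.fourierInv_eq]
    refine integral_congr_ae (Eventually.of_forall fun ξ => ?_)
    simp only [hFf, hg, RCLike.inner_apply, conj_trivial, Circle.smul_def, smul_eq_mul]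
    rw [mul_comm x ξ]
    ring
  have e2 : ∫ y, ‖f y‖ = ∫ y, ‖K y‖ := by
    have h2 := Measure.integral_comp_mul_left (fun z => ‖K z‖) l
    simp only [hf, norm_mul, Complex.norm_real, Real.norm_of_nonneg hl.le]
    rw [integral_const_mul, h2, abs_of_pos (inv_pos.2 hl), smul_eq_mul, mul_inv_cancel_left₀ hl.ne']
  rw [e, ← e2, ← integral_mul_const]
  refine norm_integral_le_of_norm_le (hfi.norm.mul_const M) (Eventually.of_forall fun y => ?_)
  rw [norm_mul]
  gcongr
  exact hM _

theorem LPFamily.hasSum_nat (χ : LPFamily) {ξ : ℝ} (h0 : ξ ≠ 0) {j : ℕ} (hξ : |ξ| ≤ 2 ^ (j + 1)) :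
    HasSum (fun l : ℕ => χ.χ (ξ / 2 ^ ((j : ℤ) + 2 - l))) 1 := by
  have hi : Function.Injective (fun l : ℕ => (j : ℤ) + 2 - l) := by
    intro a b h
    simp only at h
    omega
  have := (Function.Injective.hasSum_iff hi (f := fun k : ℤ => χ.χ (ξ / 2 ^ k)) (a := 1) ?_).2
    (χ.hsum ξ h0)
  · exact this
  · intro k hk
    by_contra hne
    have h1 := (χ.supp _ hne).1
    have h2 : (0 : ℝ) < 2 ^ k := by positivity
    rw [abs_div, abs_of_pos h2, le_div_iff₀ h2] at h1
    have h3 : (2 : ℝ) ^ k ≤ 2 ^ ((j : ℤ) + 2) := by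
      have e : (2 : ℝ) ^ ((j : ℤ) + 2) = 2 * 2 ^ (j + 1) := by
        rw [show (j : ℤ) + 2 = ((j + 2 : ℕ) : ℤ) by push_cast; rfl, zpow_natCast]; ring
      rw [e]
      linarith
    have h4 := (zpow_le_zpow_iff_right₀ (by norm_num : (1 : ℝ) < 2)).1 h3
    refine hk ⟨((j : ℤ) + 2 - k).toNat, ?_⟩
    simp only
    omega

theorem LPFamily.contDiff_sqrt_mul (χ : LPFamily) :
    ContDiff ℝ (⊤ : ℕ∞) (fun ξ => ((√|ξ| * χ.χ ξ : ℝ) : ℂ)) := by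
  refine Complex.ofRealCLM.contDiff.comp ?_
  rw [contDiff_iff_contDiffAt]
  intro x
  by_cases hx : x = 0
  · have : (fun ξ => √|ξ| * χ.χ ξ) =ᶠ[nhds x] fun _ => 0 := by
      have hball : Metric.ball (0 : ℝ) (1 / 2) ∈ nhds x := by
        rw [hx]; exact Metric.ball_mem_nhds _ (by norm_num)
      filter_upwards [hball] with y hy
      rw [mem_ball_zero_iff, Real.norm_eq_abs] at hy
      by_contra hne
      have := (χ.supp y (right_ne_zero_of_mul hne)).1
      linarith
    exact contDiffAt_const.congr_of_eventuallyEq this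
  · have h1 : ContDiffAt ℝ (⊤ : ℕ∞) (fun ξ : ℝ => |ξ|) x := contDiffAt_abs hx
    exact (h1.sqrt (abs_ne_zero.2 hx)).mul χ.smooth.contDiffAt

theorem LPFamily.hasCompactSupport (χ : LPFamily) : HasCompactSupport χ.χ := by
  refine HasCompactSupport.of_support_subset_isCompact (isCompact_Icc (a := (-2 : ℝ)) (b := 2))
    fun x hx => abs_le.1 (χ.supp x hx).2

/-- The Schwartz function `√|ξ| χ(ξ)`. -/
def LPFamily.sqrtMul (χ : LPFamily) : 𝓢(ℝ, ℂ) :=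
  HasCompactSupport.toSchwartzMap (f := fun ξ => ((√|ξ| * χ.χ ξ : ℝ) : ℂ))
    ((χ.hasCompactSupport.mul_left (f := fun ξ => √|ξ|)).comp_left
      (g := fun r : ℝ => (r : ℂ)) rfl) χ.contDiff_sqrt_mul

theorem LPFamily.sqrtMul_apply (χ : LPFamily) (ξ : ℝ) :
    χ.sqrtMul ξ = ((√|ξ| * χ.χ ξ : ℝ) : ℂ) := rfl

theorem LPFamily.exists_sqrt_mul_bound (χ : LPFamily) : ∃ C : ℝ≥0, ∀ (j : ℕ) (V : ℝ → ℂ) (M : ℝ),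
    Integrable V → (∀ ξ, V ξ ≠ 0 → |ξ| ≤ 2 ^ (j + 1)) → (∀ x, ‖𝓕⁻ V x‖ ≤ M) →
    ∀ x, ‖𝓕⁻ (fun ξ => (√|ξ| : ℂ) * V ξ) x‖ ≤ C * √(2 ^ j) * M := by
  set I := ∫ y, ‖(𝓕⁻ χ.sqrtMul : 𝓢(ℝ, ℂ)) y‖ with hI
  have hI0 : 0 ≤ I := integral_nonneg fun _ => norm_nonneg _
  have hq : (1 / √2 : ℝ) < 1 := by
    rw [div_lt_one (by positivity)]
    exact Real.lt_sqrt_of_sq_lt (by norm_num)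
  have hgeo := summable_geometric_of_lt_one (by positivity) hq
  obtain ⟨D, hD⟩ := χ.sqrtMul.toBoundedContinuousFunction.bddAbove_range_norm_comp
  refine ⟨(2 * I * ∑' l : ℕ, (1 / √2 : ℝ) ^ l).toNNReal, ?_⟩
  intro j V M hV hsupp hM x
  have hw : ∀ l : ℕ, √(2 ^ ((j : ℤ) + 2 - l)) = 2 * √(2 ^ j) * (1 / √2 : ℝ) ^ l := by
    intro l
    rw [Real.sqrt_eq_iff_mul_self_eq (by positivity) (by positivity)]
    have h1 : (√2 : ℝ) ^ l * √2 ^ l = 2 ^ l := by rw [← mul_pow, Real.mul_self_sqrt (by norm_num)]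
    have h2 : √((2 : ℝ) ^ j) * √(2 ^ j) = 2 ^ j := Real.mul_self_sqrt (by positivity)
    rw [zpow_sub₀ (by norm_num), zpow_add₀ (by norm_num), zpow_natCast, zpow_natCast, one_div,
      inv_pow, ← h1, div_eq_mul_inv, mul_inv,
      show (2 : ℝ) ^ (2 : ℤ) = 4 by norm_num]
    linear_combination (-4 * (√2 ^ l)⁻¹ * (√2 ^ l)⁻¹) * h2
  set f : ℕ → ℝ → ℂ := fun l ξ => (√(2 ^ ((j : ℤ) + 2 - l)) : ℂ) *
    (χ.sqrtMul (ξ / 2 ^ ((j : ℤ) + 2 - l)) * V ξ) with hf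
  have hsum : ∀ ξ, HasSum (fun l => f l ξ) ((√|ξ| : ℂ) * V ξ) := by
    intro ξ
    by_cases h0 : ξ = 0
    · simp [hf, h0, χ.sqrtMul_apply]
    by_cases h1 : V ξ = 0
    · simp only [hf, h1, mul_zero]; exact hasSum_zero
    have := (Complex.hasSum_ofReal (f := fun l : ℕ => χ.χ (ξ / 2 ^ ((j : ℤ) + 2 - l))).2
      (χ.hasSum_nat h0 (hsupp ξ h1))).mul_left ((√|ξ| : ℂ) * V ξ)
    rw [Complex.ofReal_one, mul_one] at this
    have e : (fun l => f l ξ) = fun l : ℕ =>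
        (√|ξ| : ℂ) * V ξ * (χ.χ (ξ / 2 ^ ((j : ℤ) + 2 - l)) : ℂ) := by
      funext l
      have h2 : (0 : ℝ) < 2 ^ ((j : ℤ) + 2 - l) := by positivity
      simp only [hf, χ.sqrtMul_apply, abs_div, abs_of_pos h2, Real.sqrt_div (abs_nonneg ξ)]
      have h3 : ((√(2 ^ ((j : ℤ) + 2 - l)) : ℝ) : ℂ) ≠ 0 := by
        exact_mod_cast (Real.sqrt_pos.2 h2).ne'
      push_cast
      field_simp
    rw [e]
    exact this
  have hfi : ∀ l, Integrable (f l) := by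
    intro l
    refine (hV.bdd_mul (c := D) ?_ ?_).const_mul _
    · exact (χ.sqrtMul.continuous.comp (continuous_id.div_const _)).aestronglyMeasurable
    · exact Eventually.of_forall fun ξ => hD ⟨_, rfl⟩
  set F : ℕ → ℝ → ℂ := fun l ξ => (𝐞 (inner ℝ ξ x) : Circle) • f l ξ with hF
  have hFn : ∀ l ξ, ‖F l ξ‖ = ‖f l ξ‖ := fun l ξ => by simp [hF]
  have hFi : ∀ l, Integrable (F l) := by
    intro l
    have := (Real.fourierIntegral_convergent_iff (f := f l) (μ := volume) (-x)).2 (hfi l)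
    simpa [hF] using this
  have hS : Summable fun l => ∫ ξ, ‖F l ξ‖ := by
    refine Summable.of_nonneg_of_le (fun l => integral_nonneg fun _ => norm_nonneg _) (fun l => ?_)
      (hgeo.mul_left (2 * √(2 ^ j) * (D * ∫ ξ, ‖V ξ‖)))
    simp only [hFn, hf, norm_mul]
    rw [integral_const_mul, Complex.norm_real, Real.norm_of_nonneg (Real.sqrt_nonneg _), hw,
      mul_right_comm]
    have hle : ∫ ξ, ‖χ.sqrtMul (ξ / 2 ^ ((j : ℤ) + 2 - l))‖ * ‖V ξ‖ ≤ ∫ ξ, D * ‖V ξ‖ := by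
      refine integral_mono_of_nonneg (Eventually.of_forall fun _ => by positivity)
        (hV.norm.const_mul _) (Eventually.of_forall fun ξ => ?_)
      simp only
      gcongr
      exact hD ⟨_, rfl⟩
    rw [integral_const_mul] at hle
    gcongr
  have key := hasSum_integral_of_summable_integral_norm hFi hS
  have e : (∫ ξ, ∑' l, F l ξ) = 𝓕⁻ (fun ξ => (√|ξ| : ℂ) * V ξ) x := by
    rw [Real.fourierInv_eq]
    refine integral_congr_ae (Eventually.of_forall fun ξ => ?_)
    exact ((hsum ξ).const_smul (𝐞 (inner ℝ ξ x) : Circle)).tsum_eq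
  rw [e] at key
  have hb : ∀ l, ‖∫ ξ, F l ξ‖ ≤ (2 * √(2 ^ j) * (I * M)) * (1 / √2 : ℝ) ^ l := by
    intro l
    have h2 : (0 : ℝ) < 2 ^ ((j : ℤ) + 2 - l) := by positivity
    have := norm_fourierInv_dilate_mul_le χ.sqrtMul hV hM h2 x
    have e3 : ∫ ξ, F l ξ = (√(2 ^ ((j : ℤ) + 2 - l)) : ℂ) *
        𝓕⁻ (fun ξ => χ.sqrtMul (ξ / 2 ^ ((j : ℤ) + 2 - l)) * V ξ) x := by
      rw [Real.fourierInv_eq, ← integral_const_mul]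
      refine integral_congr_ae (Eventually.of_forall fun ξ => ?_)
      simp only [hF, hf, Circle.smul_def, smul_eq_mul]
      ring
    rw [e3, norm_mul, Complex.norm_real, Real.norm_of_nonneg (Real.sqrt_nonneg _), hw,
      mul_right_comm]
    gcongr
  have := key.norm_le_of_bounded (hgeo.hasSum.mul_left _) hb
  refine this.trans (le_of_eq ?_)
  rw [Real.coe_toNNReal _
    (mul_nonneg (by positivity) (tsum_nonneg fun _ => by positivity))]
  ring

/-- A decomposition `F = ∑ P j` into pieces living at frequencies `|ξ| ≲ 2 ^ j`, with
`‖𝓕⁻ (P j)‖_∞ ≤ w ^ j M` and `‖P j‖_2 ≤ (w q) ^ j S`. -/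
structure DyadicDecomp (q w : ℝ≥0) (F : ℝ → ℂ) (P : ℕ → ℝ → ℂ) (M S : ℝ≥0) : Prop where
  intBdd : ∀ j, IntBdd (P j)
  hasSum : ∀ ξ, HasSum (fun j => P j ξ) (F ξ)
  supp : ∀ j ξ, P j ξ ≠ 0 → |ξ| ≤ 2 ^ (j + 1)
  sup_le : ∀ j x, ‖𝓕⁻ (P j) x‖ ≤ (w ^ j * M : ℝ≥0)
  eLpNorm_le : ∀ j, eLpNorm (P j) 2 ≤ (w ^ j * (q ^ j * S) : ℝ≥0)

theorem DyadicDecomp.mono {q w : ℝ≥0} {F : ℝ → ℂ} {P : ℕ → ℝ → ℂ} {M S M' S' : ℝ≥0}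
    (h : DyadicDecomp q w F P M S) (hM : M ≤ M') (hS : S ≤ S') : DyadicDecomp q w F P M' S' where
  intBdd := h.intBdd
  hasSum := h.hasSum
  supp := h.supp
  sup_le j x := (h.sup_le j x).trans (by gcongr)
  eLpNorm_le j := (h.eLpNorm_le j).trans (by gcongr)

theorem fourierInv_conj_neg (V : ℝ → ℂ) (x : ℝ) :
    𝓕⁻ (fun ξ => starRingEnd ℂ (V (-ξ))) x = starRingEnd ℂ (𝓕⁻ V x) := by
  rw [Real.fourierInv_eq, Real.fourierInv_eq, ← integral_conj, ← integral_neg_eq_self]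
  refine integral_congr_ae (Eventually.of_forall fun ξ => ?_)
  simp only [neg_neg, Circle.smul_def, smul_eq_mul, map_mul, inner_neg_left]
  rw [← Circle.coe_inv_eq_conj, ← AddChar.map_neg_eq_inv]

theorem fourier_conj (u : ℝ → ℂ) (ξ : ℝ) :
    𝓕 (fun x => starRingEnd ℂ (u x)) ξ = starRingEnd ℂ (𝓕 u (-ξ)) := by
  rw [Real.fourier_eq, Real.fourier_eq, ← integral_conj]
  refine integral_congr_ae (Eventually.of_forall fun x => ?_)
  simp only [neg_neg, Circle.smul_def, smul_eq_mul, map_mul, inner_neg_right]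
  rw [← Circle.coe_inv_eq_conj, ← AddChar.map_neg_eq_inv]

theorem eLpNorm_conj_neg (V : ℝ → ℂ) :
    eLpNorm (fun ξ => starRingEnd ℂ (V (-ξ))) 2 = eLpNorm V 2 := by
  refine (ENNReal.pow_right_strictMono two_ne_zero).injective ?_
  simp only [eLpNorm_two_sq, RCLike.enorm_conj]
  exact lintegral_neg_eq_self (fun x => ‖V x‖ₑ ^ 2)

theorem DyadicDecomp.conj_neg {q w : ℝ≥0} {F : ℝ → ℂ} {P : ℕ → ℝ → ℂ} {M S : ℝ≥0}
    (h : DyadicDecomp q w F P M S) :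
    DyadicDecomp q w (fun ξ => starRingEnd ℂ (F (-ξ))) (fun j ξ => starRingEnd ℂ (P j (-ξ))) M S where
  intBdd j := by
    refine ⟨?_, ?_⟩
    · exact (Complex.conjLIE.integrable_comp_iff).2 (h.intBdd j).integrable.comp_neg
    · obtain ⟨C, hC⟩ := (h.intBdd j).bdd
      exact ⟨C, fun x => by simpa using hC (-x)⟩
  hasSum ξ := Complex.hasSum_conj.2 (by simpa using h.hasSum (-ξ))
  supp j ξ hξ := by simpa using h.supp j (-ξ) (by simpa using hξ)
  sup_le j x := by
    rw [fourierInv_conj_neg, RCLike.norm_conj]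
    exact h.sup_le j x
  eLpNorm_le j := by
    rw [eLpNorm_conj_neg]
    exact h.eLpNorm_le j

theorem LPFamily.exists_dyadic_sqrt (χ : LPFamily) : ∃ C : ℝ≥0, 1 ≤ C ∧
    ∀ (q : ℝ≥0) (F : ℝ → ℂ) (P : ℕ → ℝ → ℂ) (M S : ℝ≥0), DyadicDecomp q 1 F P M S →
    DyadicDecomp q (NNReal.sqrt 2) (fun ξ => (√|ξ| : ℂ) * F ξ) (fun j ξ => (√|ξ| : ℂ) * P j ξ)
      (C * M) (C * S) := by
  obtain ⟨C, hC⟩ := χ.exists_sqrt_mul_bound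
  refine ⟨C + 2, le_add_left (by norm_num), fun q F P M S h => ?_⟩
  have hw : ∀ j : ℕ, √(2 ^ j) = (NNReal.sqrt 2 : ℝ) ^ j := by
    intro j
    rw [Real.coe_sqrt, NNReal.coe_ofNat, Real.sqrt_eq_iff_mul_self_eq (by positivity)
      (by positivity), ← mul_pow, Real.mul_self_sqrt (by norm_num)]
  have hpt : ∀ j ξ, ‖(√|ξ| : ℂ) * P j ξ‖ ≤ (2 * NNReal.sqrt 2 ^ j : ℝ≥0) * ‖P j ξ‖ := by
    intro j ξ
    by_cases h0 : P j ξ = 0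
    · simp [h0]
    rw [norm_mul, Complex.norm_real, Real.norm_of_nonneg (Real.sqrt_nonneg _)]
    gcongr
    push_cast
    have h1 := hw j
    rw [Real.coe_sqrt, NNReal.coe_ofNat] at h1
    rw [← h1]
    calc √|ξ| ≤ √(2 ^ 2 * 2 ^ j) := by
          refine Real.sqrt_le_sqrt ((h.supp j ξ h0).trans ?_)
          rw [pow_succ]
          nlinarith [pow_pos (two_pos : (0 : ℝ) < 2) j]
      _ = _ := by rw [Real.sqrt_mul (by norm_num), Real.sqrt_sq (by norm_num)]
  refine ⟨fun j => ⟨?_, ?_⟩, fun ξ => (h.hasSum ξ).mul_left _, fun j ξ hξ =>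
    h.supp j ξ (right_ne_zero_of_mul hξ), fun j x => ?_, fun j => ?_⟩
  · refine ((h.intBdd j).integrable.norm.const_mul _).mono' ?_ (Eventually.of_forall (hpt j))
    exact (by fun_prop : Continuous fun ξ : ℝ => (√|ξ| : ℂ)).aestronglyMeasurable.mul
      (h.intBdd j).integrable.1
  · obtain ⟨D, hD⟩ := (h.intBdd j).bdd
    exact ⟨_, fun ξ => (hpt j ξ).trans (mul_le_mul_of_nonneg_left (hD ξ) NNReal.zero_le_coe)⟩
  · refine (hC j (P j) M (h.intBdd j).integrable (h.supp j) (fun x => ?_) x).trans ?_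
    · simpa using h.sup_le j x
    · rw [hw]
      push_cast
      nlinarith [mul_nonneg (pow_nonneg (Real.sqrt_nonneg 2) j) M.coe_nonneg]
  · refine (eLpNorm_le_nnreal_smul_eLpNorm_of_ae_le_mul
      (Eventually.of_forall fun ξ => hpt j ξ) 2).trans ?_
    have h1 := h.eLpNorm_le j
    rw [one_pow, one_mul] at h1
    rw [ENNReal.smul_def, smul_eq_mul]
    refine (mul_le_mul_right h1 _).trans ?_
    rw [← ENNReal.coe_mul, ENNReal.coe_le_coe]
    calc 2 * NNReal.sqrt 2 ^ j * (q ^ j * S) = NNReal.sqrt 2 ^ j * (q ^ j * (2 * S)) := by ring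
      _ ≤ _ := by gcongr; exact le_add_self

theorem HNorm_eq (s : ℝ) (u : ℝ → ℂ) :
    HNorm s u = eLpNorm (fun ξ => (((1 + ξ ^ 2) ^ (s / 2) : ℝ) : ℂ) * 𝓕 u ξ) 2 := by
  refine (ENNReal.pow_right_strictMono two_ne_zero).injective ?_
  rw [eLpNorm_two_sq, HNorm, ← ENNReal.rpow_natCast, ← ENNReal.rpow_mul]
  norm_num
  refine lintegral_congr fun ξ => ?_
  rw [mul_pow]
  congr 1
  have h0 : (0 : ℝ) ≤ 1 + ξ ^ 2 := by positivity
  rw [← ofReal_norm, Complex.norm_real, Real.norm_of_nonneg (by positivity),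
    ← ENNReal.ofReal_pow (by positivity), ← Real.rpow_mul_natCast h0]
  norm_num

theorem continuous_fourier {u : ℝ → ℂ} (hu : Integrable u) : Continuous (𝓕 u) :=
  VectorFourier.fourierIntegral_continuous Real.continuous_fourierChar
    (by exact continuous_inner) hu

theorem continuous_weight (s : ℝ) : Continuous fun ξ : ℝ => (((1 + ξ ^ 2) ^ s : ℝ) : ℂ) :=
  Complex.continuous_ofReal.comp
    ((by fun_prop : Continuous fun ξ : ℝ => 1 + ξ ^ 2).rpow_const
      fun ξ => Or.inl (by positivity))

theorem memLp_weight_mul_fourier {s : ℝ} {u : ℝ → ℂ} (hu : Integrable u) (hs : HNorm s u < ⊤) :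
    MemLp (fun ξ => (((1 + ξ ^ 2) ^ (s / 2) : ℝ) : ℂ) * 𝓕 u ξ) 2 :=
  ⟨((continuous_weight _).mul (continuous_fourier hu)).aestronglyMeasurable, HNorm_eq s u ▸ hs⟩

theorem integrable_fourier_of_HNorm {s : ℝ} (hs : 1 / 2 < s) {u : ℝ → ℂ} (hu : Integrable u)
    (h : HNorm s u < ⊤) : Integrable (𝓕 u) := by
  have h1 := memLp_weight_mul_fourier hu h
  have h2 : MemLp (fun ξ : ℝ => (((1 + ξ ^ 2) ^ (-s / 2) : ℝ) : ℂ)) 2 := by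
    rw [memLp_two_iff_integrable_sq_norm (continuous_weight _).aestronglyMeasurable]
    have := integrable_rpow_neg_one_add_norm_sq (E := ℝ) (μ := volume) (r := 2 * s)
      (by simp; linarith)
    refine this.congr (Eventually.of_forall fun ξ => ?_)
    have h0 : (0 : ℝ) ≤ 1 + ξ ^ 2 := by positivity
    simp only [Complex.norm_real, Real.norm_eq_abs, sq_abs]
    rw [← Real.rpow_mul_natCast h0]
    congr 1
    push_cast
    ring
  refine (h2.integrable_mul h1).congr (Eventually.of_forall fun ξ => ?_)
  have h0 : (0 : ℝ) < 1 + ξ ^ 2 := by positivity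
  simp only [Pi.mul_apply]
  rw [← mul_assoc, ← Complex.ofReal_mul, ← Real.rpow_add h0]
  simp [neg_div]

theorem eLpNorm_le_HNorm {s : ℝ} {u W : ℝ → ℂ} {κ : ℝ≥0}
    (h : ∀ ξ, ‖W ξ‖ ≤ κ * ((1 + ξ ^ 2) ^ (s / 2) * ‖𝓕 u ξ‖)) :
    eLpNorm W 2 ≤ κ * HNorm s u := by
  rw [HNorm_eq]
  refine eLpNorm_le_nnreal_smul_eLpNorm_of_ae_le_mul (Eventually.of_forall fun ξ => ?_) 2
  rw [← NNReal.coe_le_coe, NNReal.coe_mul, coe_nnnorm, coe_nnnorm, norm_mul, Complex.norm_real,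
    Real.norm_of_nonneg (by positivity)]
  exact h ξ

theorem LPFamily.zero_apply (χ : LPFamily) : χ.χ 0 = 0 := by
  by_contra h
  have := (χ.supp 0 h).1
  norm_num at this

theorem LPFamily.exists_bound (χ : LPFamily) : ∃ D : ℝ≥0, ∀ x, |χ.χ x| ≤ D := by
  obtain ⟨D, hD⟩ := χ.smooth.continuous.bounded_above_of_compact_support χ.hasCompactSupport
  exact ⟨D.toNNReal, fun x => (hD x).trans (Real.le_coe_toNNReal D)⟩

theorem LPFamily.summable_nat (χ : LPFamily) (ξ : ℝ) :
    Summable fun k : ℕ => χ.χ (ξ / 2 ^ (k + 1)) := by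
  by_cases h0 : ξ = 0
  · simp [h0, χ.zero_apply, summable_zero]
  have hi : Function.Injective (fun k : ℕ => ((k + 1 : ℕ) : ℤ)) := fun a b h => by
    simp only at h; omega
  have := (χ.hsum ξ h0).summable.comp_injective hi
  simpa only [Function.comp_def, zpow_natCast] using this

/-- The symbol of the low-frequency projection. -/
def LPFamily.low (χ : LPFamily) (ξ : ℝ) : ℝ := 1 - ∑' k : ℕ, χ.χ (ξ / 2 ^ (k + 1))

theorem LPFamily.low_eq (χ : LPFamily) :
    χ.low = (Set.Icc (-2) 2).indicator fun ξ => 1 - χ.χ (ξ / 2) - χ.χ (ξ / 4) := by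
  funext ξ
  by_cases hξ : ξ ∈ Set.Icc (-2 : ℝ) 2
  · rw [Set.indicator_of_mem hξ, LPFamily.low, tsum_eq_sum (s := Finset.range 2)]
    · simp only [Finset.sum_range_succ, Finset.sum_range_zero]
      norm_num
      ring
    · intro k hk
      by_contra hne
      have h1 := (χ.supp _ hne).1
      have h2 : (0 : ℝ) < 2 ^ (k + 1) := by positivity
      rw [abs_div, abs_of_pos h2, le_div_iff₀ h2] at h1
      have h3 : (2 : ℝ) ^ 3 ≤ 2 ^ (k + 1) :=
        pow_le_pow_right₀ (by norm_num) (by simp at hk; omega)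
      have h4 := abs_le.2 hξ
      linarith
  · rw [Set.indicator_of_notMem hξ, LPFamily.low]
    have h2 : 2 < |ξ| := by
      by_contra h; exact hξ (abs_le.1 (not_lt.1 h))
    have h0 : ξ ≠ 0 := by rintro rfl; norm_num at h2
    have hi : Function.Injective (fun k : ℕ => ((k + 1 : ℕ) : ℤ)) := fun a b h => by
      simp only at h; omega
    have := (Function.Injective.hasSum_iff hi (f := fun k : ℤ => χ.χ (ξ / 2 ^ k)) (a := 1) ?_).2
      (χ.hsum ξ h0)
    · have e : ∑' k : ℕ, χ.χ (ξ / 2 ^ (k + 1)) = 1 := this.tsum_eq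
      rw [e, sub_self]
    · intro k hk
      by_contra hne
      have h1 := (χ.supp _ hne).2
      have h3 : (0 : ℝ) < 2 ^ k := by positivity
      rw [abs_div, abs_of_pos h3, div_le_iff₀ h3] at h1
      have h4 : (1 : ℝ) < 2 ^ k := by linarith
      have h5 : (0 : ℤ) < k := by
        by_contra h
        exact absurd (zpow_le_one_of_nonpos₀ (by norm_num : (1 : ℝ) ≤ 2) (not_lt.1 h)) (not_le.2 h4)
      exact hk ⟨(k - 1).toNat, by simp only; omega⟩

/-- The Littlewood-Paley pieces of a function on the frequency side. -/
def LPFamily.piece (χ : LPFamily) (U : ℝ → ℂ) : ℕ → ℝ → ℂ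
  | 0 => fun ξ => (χ.low ξ : ℂ) * U ξ
  | j + 1 => fun ξ => (χ.χ (ξ / 2 ^ ((j : ℤ) + 1)) : ℂ) * U ξ

theorem LPFamily.hasSum_piece (χ : LPFamily) (U : ℝ → ℂ) (ξ : ℝ) :
    HasSum (fun j => χ.piece U j ξ) (U ξ) := by
  rw [← hasSum_nat_add_iff' 1]
  have h := ((Complex.hasSum_ofReal.2 (χ.summable_nat ξ).hasSum).mul_right (U ξ))
  have e : U ξ - ∑ i ∈ Finset.range 1, χ.piece U i ξ =
      ((∑' k : ℕ, χ.χ (ξ / 2 ^ (k + 1)) : ℝ) : ℂ) * U ξ := by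
    simp only [Finset.sum_range_one, LPFamily.piece, LPFamily.low]
    push_cast
    ring
  rw [e]
  exact h

theorem LPFamily.exists_dyadic (χ : LPFamily) {s ρ : ℝ} (hs : 1 / 2 < s) (hρ : 0 ≤ ρ) :
    ∃ c : ℝ≥0, ∀ (u : ℝ → ℂ) (B S : ℝ≥0), Integrable u → HNorm s u = S →
      BesovNorm χ.χ ρ u = B →
      DyadicDecomp (2 ^ (-s)) 1 (𝓕 u) (χ.piece (𝓕 u)) B (c * S) := by
  obtain ⟨D, hD⟩ := χ.exists_bound
  refine ⟨1 + D + D + D * 2 ^ s, fun u B S hu hS hB => ?_⟩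
  have hU := continuous_fourier hu
  have hUi : Integrable (𝓕 u) := integrable_fourier_of_HNorm hs hu (hS ▸ ENNReal.coe_lt_top)
  have hUb : ∀ ξ, ‖𝓕 u ξ‖ ≤ ∫ x, ‖u x‖ := fun ξ =>
    VectorFourier.norm_fourierIntegral_le_integral_norm _ _ _ _ _
  have hlow : ∀ ξ, |χ.low ξ| ≤ 1 + D + D := by
    intro ξ
    rw [χ.low_eq]
    refine (norm_indicator_le_norm_self (fun ξ => 1 - χ.χ (ξ / 2) - χ.χ (ξ / 4)) ξ).trans ?_
    rw [Real.norm_eq_abs]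
    refine (abs_sub _ _).trans (add_le_add ((abs_sub _ _).trans (add_le_add (by simp) (hD _))) (hD _))
  have hlowm : Measurable χ.low := by
    rw [χ.low_eq]
    have := χ.smooth.continuous
    exact (by fun_prop : Continuous fun ξ => 1 - χ.χ (ξ / 2) - χ.χ (ξ / 4)).measurable.indicator
      measurableSet_Icc
  have hmul : ∀ (m : ℝ → ℝ) (K : ℝ), Measurable m → (∀ ξ, |m ξ| ≤ K) →
      IntBdd fun ξ => (m ξ : ℂ) * 𝓕 u ξ := by
    intro m K hm hK
    refine ⟨hUi.bdd_mul (c := K) (Complex.measurable_ofReal.comp hm).aestronglyMeasurable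
      (Eventually.of_forall fun ξ => by simpa using hK ξ), K * ∫ x, ‖u x‖, fun ξ => ?_⟩
    rw [norm_mul, Complex.norm_real, Real.norm_eq_abs]
    exact mul_le_mul (hK ξ) (hUb ξ) (norm_nonneg _) ((abs_nonneg _).trans (hK ξ))
  have hone : ∀ ξ : ℝ, 1 ≤ (1 + ξ ^ 2) ^ (s / 2) := fun ξ =>
    Real.one_le_rpow (by nlinarith [sq_nonneg ξ]) (by linarith)
  have hsupB : ∀ j x, (‖𝓕⁻ (χ.piece (𝓕 u) j) x‖₊ : ℝ≥0∞) ≤ B := by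
    intro j x
    rw [← hB, BesovNorm]
    cases j with
    | zero => exact le_sup_of_le_left (le_iSup (fun x => (‖LPlow χ.χ u x‖₊ : ℝ≥0∞)) x)
    | succ j =>
      refine le_sup_of_le_right (le_trans ?_ (le_iSup (fun k : ℕ =>
        ENNReal.ofReal ((2 : ℝ) ^ (ρ * ((k : ℝ) + 1))) * LooNorm (LP χ.χ (k + 1) u)) j))
      refine (le_iSup (fun x => (‖LP χ.χ (j + 1) u x‖₊ : ℝ≥0∞)) x).trans ?_
      refine le_mul_of_one_le_left zero_le ?_
      rw [ENNReal.one_le_ofReal]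
      exact Real.one_le_rpow (by norm_num) (by positivity)
  refine ⟨fun j => ?_, χ.hasSum_piece _, fun j ξ hξ => ?_, fun j x => ?_, fun j => ?_⟩
  · cases j with
    | zero => exact hmul _ _ hlowm hlow
    | succ j =>
      exact hmul (fun ξ => χ.χ (ξ / 2 ^ ((j : ℤ) + 1))) D
        (χ.smooth.continuous.comp (continuous_id.div_const _)).measurable fun ξ => hD _
  · cases j with
    | zero =>
      have h1 : χ.low ξ ≠ 0 := by
        have := left_ne_zero_of_mul hξ
        exact_mod_cast this
      rw [χ.low_eq] at h1
      have h2 : ξ ∈ Set.Icc (-2 : ℝ) 2 := Set.mem_of_indicator_ne_zero h1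
      simpa using abs_le.2 h2
    | succ j =>
      have h1 : χ.χ (ξ / 2 ^ ((j : ℤ) + 1)) ≠ 0 := by
        have := left_ne_zero_of_mul hξ
        exact_mod_cast this
      have h2 := (χ.supp _ h1).2
      have h3 : (0 : ℝ) < 2 ^ ((j : ℤ) + 1) := by positivity
      rw [abs_div, abs_of_pos h3, div_le_iff₀ h3] at h2
      refine h2.trans (le_of_eq ?_)
      norm_cast
      ring
  · have := hsupB j x
    rw [one_pow, one_mul]
    exact_mod_cast this
  · rw [one_pow, one_mul]
    cases j with
    | zero =>
      refine (eLpNorm_le_HNorm (s := s) (u := u) (κ := 1 + D + D) fun ξ => ?_).trans ?_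
      · rw [LPFamily.piece, norm_mul, Complex.norm_real, Real.norm_eq_abs]
        refine mul_le_mul (hlow ξ) ?_ (norm_nonneg _) (by positivity)
        exact le_mul_of_one_le_left (norm_nonneg _) (hone ξ)
      · rw [hS, ← ENNReal.coe_mul, ENNReal.coe_le_coe, pow_zero, one_mul]
        exact mul_le_mul' le_self_add le_rfl
    | succ j =>
      refine (eLpNorm_le_HNorm (s := s) (u := u)
        (κ := (2 ^ (-s)) ^ (j + 1) * (D * 2 ^ s)) fun ξ => ?_).trans ?_
      · rw [LPFamily.piece, norm_mul, Complex.norm_real, Real.norm_eq_abs]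
        by_cases h1 : χ.χ (ξ / 2 ^ ((j : ℤ) + 1)) = 0
        · rw [h1, abs_zero, zero_mul]; positivity
        have h2 := (χ.supp _ h1).1
        have h3 : (0 : ℝ) < 2 ^ ((j : ℤ) + 1) := by positivity
        rw [abs_div, abs_of_pos h3, le_div_iff₀ h3] at h2
        have h4 : (2 : ℝ) ^ j ≤ |ξ| := by
          refine le_trans (le_of_eq ?_) h2
          rw [zpow_add₀ (by norm_num), zpow_natCast]
          ring
        have h5 : ((2 : ℝ) ^ s) ^ j ≤ (1 + ξ ^ 2) ^ (s / 2) := by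
          calc ((2 : ℝ) ^ s) ^ j = (((2 : ℝ) ^ j) ^ 2) ^ (s / 2) := by
                rw [← Real.rpow_natCast, ← Real.rpow_natCast, ← Real.rpow_natCast,
                  ← Real.rpow_mul (by positivity), ← Real.rpow_mul (by positivity),
                  ← Real.rpow_mul (by positivity)]
                congr 1
                push_cast
                ring
            _ ≤ _ := by
                refine Real.rpow_le_rpow (by positivity) ?_ (by linarith)
                rw [← sq_abs ξ]
                nlinarith [pow_le_pow_left₀ (by positivity) h4 2]
        have h6 : (1 : ℝ) ≤ ((2 : ℝ) ^ (-s)) ^ (j + 1) * 2 ^ s * (1 + ξ ^ 2) ^ (s / 2) := by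
          calc (1 : ℝ) = ((2 : ℝ) ^ (-s)) ^ (j + 1) * 2 ^ s * (2 ^ s) ^ j := by
                rw [mul_assoc, ← pow_succ', ← mul_pow, ← Real.rpow_add (by norm_num)]
                simp
            _ ≤ _ := by gcongr
        push_cast
        calc |χ.χ (ξ / 2 ^ ((j : ℤ) + 1))| * ‖𝓕 u ξ‖ ≤ D * ‖𝓕 u ξ‖ * 1 := by
              rw [mul_one]; gcongr; exact hD _
          _ ≤ D * ‖𝓕 u ξ‖ * (((2 : ℝ) ^ (-s)) ^ (j + 1) * 2 ^ s * (1 + ξ ^ 2) ^ (s / 2)) := by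
              gcongr
          _ = _ := by ring
      · rw [hS, ← ENNReal.coe_mul, ENNReal.coe_le_coe, mul_assoc]
        gcongr
        exact le_add_self

theorem eLpNorm_le_tsum_of_hasSum {ι : Type*} [Denumerable ι] {f : ι → ℝ → ℂ} {g : ℝ → ℂ}
    (hf : ∀ i, AEStronglyMeasurable (f i)) (h : ∀ x, HasSum (fun i => f i x) (g x)) :
    eLpNorm g 2 ≤ ∑' i, eLpNorm (f i) 2 := by
  set e : ℕ ≃ ι := (Denumerable.eqv ι).symm
  have h1 : ∀ᵐ x, Tendsto (fun n => (∑ i ∈ Finset.range n, f (e i)) x) atTop (nhds (g x)) :=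
    Eventually.of_forall fun x => by
      simpa using (e.hasSum_iff.2 (h x)).tendsto_sum_nat
  refine (Lp.eLpNorm_lim_le_liminf_eLpNorm
    (fun n => Finset.aestronglyMeasurable_sum _ fun i _ => hf (e i)) g h1).trans ?_
  refine liminf_le_of_le (by isBoundedDefault) fun b hb => ?_
  obtain ⟨n, hn⟩ := hb.exists
  refine hn.trans ((eLpNorm_sum_le (fun i _ => hf (e i)) (by norm_num)).trans ?_)
  rw [← e.tsum_eq]
  exact ENNReal.sum_le_tsum _

theorem conv_comm (V W : ℝ → ℂ) : conv V W = conv W V := by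
  funext x
  rw [conv_apply, conv_apply, ← integral_sub_left_eq_self _ volume x]
  simp only [sub_sub_cancel, mul_comm]

theorem integrable_mul_sub {V W : ℝ → ℂ} (hV : MemLp V 2) (hW : MemLp W 2) (x : ℝ) :
    Integrable fun t => V t * W (x - t) :=
  hV.integrable_mul (hW.comp_measurePreserving (volume.measurePreserving_sub_left x))

theorem integral_norm_mul_sub_le {V W : ℝ → ℂ} (hV : MemLp V 2) (hW : MemLp W 2) {v w : ℝ≥0}
    (hv : eLpNorm V 2 ≤ v) (hw : eLpNorm W 2 ≤ w) (x : ℝ) :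
    ∫ t, ‖V t * W (x - t)‖ ≤ (v * w : ℝ≥0) := by
  have hp : MeasurePreserving (fun t : ℝ => x - t) := volume.measurePreserving_sub_left x
  have h1 : eLpNorm (fun t => V t * W (x - t)) 1 ≤ (v * w : ℝ≥0) := by
    refine (eLpNorm_smul_le_mul_eLpNorm (p := 2) (q := 2)
      (hW.comp_measurePreserving hp).1 hV.1).trans ?_
    rw [ENNReal.coe_mul]
    exact mul_le_mul' hv ((eLpNorm_comp_measurePreserving hW.1 hp).trans_le hw)
  rw [integral_norm_eq_lintegral_enorm (integrable_mul_sub hV hW x).1,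
    ← eLpNorm_one_eq_lintegral_enorm]
  exact ENNReal.toReal_mono ENNReal.coe_ne_top h1

theorem DyadicDecomp.eLpNorm_indicator_le {q w : ℝ≥0} {F : ℝ → ℂ} {P : ℕ → ℝ → ℂ} {M S : ℝ≥0}
    (h : DyadicDecomp q w F P M S) (s : Set ℝ) (j : ℕ) :
    eLpNorm (s.indicator (P j)) 2 ≤ ((w * q) ^ j * S : ℝ≥0) := by
  refine (MeasureTheory.eLpNorm_indicator_le _).trans ((h.eLpNorm_le j).trans (le_of_eq ?_))
  rw [mul_pow, mul_assoc]

theorem DyadicDecomp.hasSum_indicator {q w : ℝ≥0} {F : ℝ → ℂ} {P : ℕ → ℝ → ℂ} {M S : ℝ≥0}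
    (h : DyadicDecomp q w F P M S) (s : Set ℝ) (ξ : ℝ) :
    HasSum (fun j => s.indicator (P j) ξ) (s.indicator F ξ) := by
  by_cases hξ : ξ ∈ s
  · simpa [hξ] using h.hasSum ξ
  · simp [hξ]

theorem DyadicDecomp.memLp {q w : ℝ≥0} {F : ℝ → ℂ} {P : ℕ → ℝ → ℂ} {M S : ℝ≥0}
    (h : DyadicDecomp q w F P M S) (hq : w * q < 1) : MemLp F 2 := by
  refine ⟨aestronglyMeasurable_of_tendsto_ae (atTop : Filter (Finset ℕ))
    (f := fun I => ∑ j ∈ I, P j) (fun I => Finset.aestronglyMeasurable_sum _ fun j _ =>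
      (h.intBdd j).integrable.1) (Eventually.of_forall fun ξ => ?_), ?_⟩
  · simpa only [HasSum, SummationFilter.unconditional_filter, Finset.sum_apply] using h.hasSum ξ
  · have h1 : ∀ j, eLpNorm (P j) 2 ≤ ((w * q) ^ j * S : ℝ≥0) := fun j => by
      simpa only [Set.indicator_univ] using h.eLpNorm_indicator_le Set.univ j
    refine (eLpNorm_le_tsum_of_hasSum (fun j => (h.intBdd j).integrable.1) h.hasSum).trans_lt
      ((ENNReal.tsum_le_tsum h1).trans_lt ?_)
    rw [← ENNReal.coe_tsum ((NNReal.summable_geometric hq).mul_right S)]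
    exact ENNReal.coe_lt_top

section Pair

variable {q w₁ w₂ : ℝ≥0} {F G : ℝ → ℂ} {P Q : ℕ → ℝ → ℂ} {M S : ℝ≥0} {s t : Set ℝ}

theorem DyadicDecomp.hasSum_conv (hq₁ : w₁ * q < 1) (hq₂ : w₂ * q < 1)
    (hF : DyadicDecomp q w₁ F P M S) (hG : DyadicDecomp q w₂ G Q M S) (hs : MeasurableSet s)
    (ht : MeasurableSet t) (ξ : ℝ) :
    HasSum (fun i : ℕ × ℕ => conv (s.indicator (P i.1)) (t.indicator (Q i.2)) ξ)
      (conv (s.indicator F) (t.indicator G) ξ) := by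
  have hb := fun i : ℕ × ℕ => integral_norm_mul_sub_le ((hF.intBdd i.1).indicator hs).memLp
    ((hG.intBdd i.2).indicator ht).memLp (hF.eLpNorm_indicator_le s i.1)
    (hG.eLpNorm_indicator_le t i.2) ξ
  have hsm : Summable fun i : ℕ × ℕ =>
      ∫ x, ‖s.indicator (P i.1) x * t.indicator (Q i.2) (ξ - x)‖ := by
    refine Summable.of_nonneg_of_le (fun i => integral_nonneg fun _ => norm_nonneg _)
      hb ?_
    have g₁ := NNReal.summable_coe.2 ((NNReal.summable_geometric hq₁).mul_right S)
    have g₂ := NNReal.summable_coe.2 ((NNReal.summable_geometric hq₂).mul_right S)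
    simpa only [NNReal.coe_mul] using
      g₁.mul_of_nonneg g₂ (fun _ => NNReal.coe_nonneg _) (fun _ => NNReal.coe_nonneg _)
  have key := hasSum_integral_of_summable_integral_norm (fun i : ℕ × ℕ => integrable_mul_sub
    ((hF.intBdd i.1).indicator hs).memLp ((hG.intBdd i.2).indicator ht).memLp ξ) hsm
  have e : (∫ x, ∑' i : ℕ × ℕ, s.indicator (P i.1) x * t.indicator (Q i.2) (ξ - x)) =
      conv (s.indicator F) (t.indicator G) ξ := by
    rw [conv_apply]
    refine integral_congr_ae (Eventually.of_forall fun x => ?_)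
    have h1 := hF.hasSum_indicator s x
    have h2 := hG.hasSum_indicator t (ξ - x)
    have h3 := summable_mul_of_summable_norm (f := fun j => s.indicator (P j) x)
      (g := fun k => t.indicator (Q k) (ξ - x)) h1.summable.norm h2.summable.norm
    have h4 := h1.mul h2 h3
    exact h4.tsum_eq
  rw [e] at key
  exact key

theorem DyadicDecomp.aestronglyMeasurable_conv (hq₁ : w₁ * q < 1) (hq₂ : w₂ * q < 1)
    (hF : DyadicDecomp q w₁ F P M S) (hG : DyadicDecomp q w₂ G Q M S) (hs : MeasurableSet s)
    (ht : MeasurableSet t) :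
    AEStronglyMeasurable (conv (s.indicator F) (t.indicator G)) := by
  refine aestronglyMeasurable_of_tendsto_ae (atTop : Filter (Finset (ℕ × ℕ)))
    (f := fun I => ∑ i ∈ I, conv (s.indicator (P i.1)) (t.indicator (Q i.2)))
    (fun I => Finset.aestronglyMeasurable_sum _ fun i _ =>
      (((hF.intBdd i.1).indicator hs).conv ((hG.intBdd i.2).indicator ht)).integrable.1)
    (Eventually.of_forall fun ξ => ?_)
  simpa only [HasSum, SummationFilter.unconditional_filter, Finset.sum_apply] using
    hF.hasSum_conv hq₁ hq₂ hG hs ht ξ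

theorem DyadicDecomp.abs_le_of_conv_ne_zero (hF : DyadicDecomp q w₁ F P M S)
    (hG : DyadicDecomp q w₂ G Q M S) {j k : ℕ} {ξ : ℝ}
    (h : conv (s.indicator (P j)) (t.indicator (Q k)) ξ ≠ 0) : |ξ| ≤ 2 ^ (max j k + 2) := by
  by_contra hξ
  refine h ?_
  rw [conv_apply, ← integral_zero ℝ ℂ]
  refine integral_congr_ae (Eventually.of_forall fun x => ?_)
  by_contra hne
  have h1 := hF.supp j x fun h0 => hne (by simp [Set.indicator, h0])
  have h2 := hG.supp k (ξ - x) fun h0 => hne (by simp [Set.indicator, h0])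
  have h3 : (2 : ℝ) ^ (j + 1) ≤ 2 ^ (max j k + 1) :=
    pow_le_pow_right₀ (by norm_num) (by simp)
  have h4 : (2 : ℝ) ^ (k + 1) ≤ 2 ^ (max j k + 1) :=
    pow_le_pow_right₀ (by norm_num) (by simp)
  have h5 := abs_add_le x (ξ - x)
  rw [add_sub_cancel] at h5
  rw [pow_succ] at hξ
  linarith

end Pair

theorem exists_weight_conv_bound {q w₁ w₂ p : ℝ≥0} (c : ℝ≥0) {m : ℕ} {θ : ℝ}
    (hθ : θ * (m + 2) = 1) (hw₁ : 1 ≤ w₁) (hw₂ : 1 ≤ w₂) (hq₁ : w₁ * q < 1) (hq₂ : w₂ * q < 1)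
    (ha : p * w₁ * w₂ * q ^ (1 - θ) < 1) :
    ∃ C : ℝ≥0, ∀ (F G : ℝ → ℂ) (P Q : ℕ → ℝ → ℂ) (M S : ℝ≥0) (s t : Set ℝ) (ω : ℝ → ℂ),
    DyadicDecomp q w₁ F P M S → DyadicDecomp q w₂ G Q M S → IsHalfLine s → IsHalfLine t →
    Measurable ω → (∀ (n : ℕ) ξ, |ξ| ≤ 2 ^ (n + 2) → ‖ω ξ‖ ≤ (c * p ^ n : ℝ≥0)) →
    eLpNorm (fun ξ => ω ξ * conv (s.indicator F) (t.indicator G) ξ) 2 ≤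
      (C * (M * S) : ℝ≥0) := by
  obtain ⟨C, hC⟩ := exists_eLpNorm_conv_le m hθ
  set a : ℝ≥0 := p * w₁ * w₂ * q ^ (1 - θ)
  set b : ℝ≥0 := NNReal.sqrt a
  have hba : b * b = a := NNReal.mul_self_sqrt a
  have hb : b < 1 := by
    by_contra! h
    exact absurd ha (not_lt.2 (hba ▸ one_le_mul h h))
  have hq : q ≤ 1 := (le_mul_of_one_le_left zero_le hw₁).trans hq₁.le
  have hgeo := NNReal.summable_geometric hb
  refine ⟨c * C * ((∑' j : ℕ, b ^ j) * ∑' k : ℕ, b ^ k), ?_⟩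
  intro F G P Q M S s t ω hF hG hs ht hω hωb
  have iF := fun j => (hF.intBdd j).indicator hs.measurableSet
  have iG := fun j => (hG.intBdd j).indicator ht.measurableSet
  have hpair : ∀ j k, eLpNorm (conv (s.indicator (P j)) (t.indicator (Q k))) 2 ≤
      (C * (w₁ ^ j * w₂ ^ k * M * S * (q ^ max j k) ^ (1 - θ)) : ℝ≥0) := by
    have hle : ∀ (w : ℝ≥0) (i : ℕ), w ^ i * (q ^ i * S) ≤ w ^ i * S := fun w i => by
      gcongr
      exact mul_le_of_le_one_left zero_le (pow_le_one₀ zero_le hq)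
    intro j k
    rcases le_total j k with h | h
    · rw [max_eq_right h]
      exact hC _ _ s t _ _ M S _ (hF.intBdd j) (hG.intBdd k) hs ht (hF.sup_le j) (hG.sup_le k)
        ((hF.eLpNorm_le j).trans (by exact_mod_cast hle w₁ j)) (hG.eLpNorm_le k)
    · rw [max_eq_left h, conv_comm, mul_comm (w₁ ^ j)]
      exact hC _ _ t s _ _ M S _ (hG.intBdd k) (hF.intBdd j) ht hs (hG.sup_le k) (hF.sup_le j)
        ((hG.eLpNorm_le k).trans (by exact_mod_cast hle w₂ k)) (hF.eLpNorm_le j)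
  have hterm : ∀ i : ℕ × ℕ, eLpNorm (fun ξ => ω ξ *
      conv (s.indicator (P i.1)) (t.indicator (Q i.2)) ξ) 2 ≤
      (c * C * (M * S) * (b ^ i.1 * b ^ i.2) : ℝ≥0) := by
    rintro ⟨j, k⟩
    refine (eLpNorm_le_nnreal_smul_eLpNorm_of_ae_le_mul (c := c * p ^ max j k)
      (g := conv (s.indicator (P j)) (t.indicator (Q k)))
      (Eventually.of_forall fun ξ => ?_) 2).trans ?_
    · by_cases h0 : conv (s.indicator (P j)) (t.indicator (Q k)) ξ = 0
      · simp [h0]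
      · rw [nnnorm_mul]
        exact mul_le_mul' (hωb _ ξ (hF.abs_le_of_conv_ne_zero hG h0)) le_rfl
    · rw [ENNReal.smul_def, smul_eq_mul]
      refine (mul_le_mul_right (hpair j k) _).trans ?_
      rw [← ENNReal.coe_mul, ENNReal.coe_le_coe]
      have e1 : w₁ ^ j ≤ w₁ ^ max j k := pow_le_pow_right₀ hw₁ (le_max_left _ _)
      have e2 : w₂ ^ k ≤ w₂ ^ max j k := pow_le_pow_right₀ hw₂ (le_max_right _ _)
      have e3 : a ^ max j k ≤ b ^ j * b ^ k := by
        rw [← hba, mul_pow, ← pow_add, ← pow_add]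
        exact pow_le_pow_of_le_one zero_le hb.le (by omega)
      have e4 : (q ^ max j k) ^ (1 - θ) = (q ^ (1 - θ)) ^ max j k := by
        rw [← NNReal.rpow_natCast, ← NNReal.rpow_natCast, ← NNReal.rpow_mul, ← NNReal.rpow_mul,
          mul_comm]
      calc c * p ^ max j k * (C * (w₁ ^ j * w₂ ^ k * M * S * (q ^ max j k) ^ (1 - θ)))
          ≤ c * p ^ max j k *
            (C * (w₁ ^ max j k * w₂ ^ max j k * M * S * (q ^ max j k) ^ (1 - θ))) := by gcongr
        _ = c * C * (M * S) * a ^ max j k := by rw [e4]; simp only [a, mul_pow]; ring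
        _ ≤ _ := by gcongr
  refine (eLpNorm_le_tsum_of_hasSum (ι := ℕ × ℕ)
    (f := fun i ξ => ω ξ * conv (s.indicator (P i.1)) (t.indicator (Q i.2)) ξ)
    (fun i => hω.aestronglyMeasurable.mul ((iF i.1).conv (iG i.2)).integrable.1)
    (fun ξ => (hF.hasSum_conv hq₁ hq₂ hG hs.measurableSet ht.measurableSet ξ).mul_left _)).trans ?_
  refine (ENNReal.tsum_le_tsum hterm).trans (le_of_eq ?_)
  rw [ENNReal.tsum_prod (f := fun j k : ℕ => ((c * C * (M * S) * (b ^ j * b ^ k) : ℝ≥0) : ℝ≥0∞))]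
  push_cast [ENNReal.coe_tsum hgeo]
  simp only [ENNReal.tsum_mul_left, ENNReal.tsum_mul_right]
  ring

theorem sobolevWeight_le {γ e : ℝ} (hγ : 0 ≤ γ) (he : 0 ≤ e) (n : ℕ) {ξ : ℝ}
    (hξ : |ξ| ≤ 2 ^ (n + 2)) :
    (1 + ξ ^ 2) ^ (γ / 2) * |ξ| ^ e ≤
      (2 : ℝ) ^ (5 * γ / 2 + 2 * e) * ((2 : ℝ) ^ (γ + e)) ^ n := by
  have h0 : (0 : ℝ) < 2 := two_pos
  have h1 : 1 + ξ ^ 2 ≤ (2 : ℝ) ^ ((2 * n + 5 : ℕ) : ℝ) := by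
    rw [Real.rpow_natCast, ← sq_abs]
    have h2 : |ξ| ^ 2 ≤ (2 ^ (n + 2)) ^ 2 := by gcongr
    have h3 : (1 : ℝ) ≤ (2 ^ (n + 2)) ^ 2 := one_le_pow₀ (one_le_pow₀ one_le_two)
    calc 1 + |ξ| ^ 2 ≤ (2 ^ (n + 2)) ^ 2 + (2 ^ (n + 2)) ^ 2 := add_le_add h3 h2
      _ = 2 ^ (2 * n + 5) := by ring
  have h4 : |ξ| ≤ (2 : ℝ) ^ ((n + 2 : ℕ) : ℝ) := by rwa [Real.rpow_natCast]
  calc (1 + ξ ^ 2) ^ (γ / 2) * |ξ| ^ e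
      ≤ ((2 : ℝ) ^ ((2 * n + 5 : ℕ) : ℝ)) ^ (γ / 2) * ((2 : ℝ) ^ ((n + 2 : ℕ) : ℝ)) ^ e := by
        gcongr
    _ = _ := by
        rw [← Real.rpow_natCast (2 ^ (γ + e)), ← Real.rpow_mul h0.le, ← Real.rpow_mul h0.le,
          ← Real.rpow_mul h0.le, ← Real.rpow_add h0, ← Real.rpow_add h0]
        congr 1
        push_cast
        ring

theorem exists_sobolev_conv_bound {σ γ d₁ d₂ : ℝ} (hγ : 0 ≤ γ) (hσ : γ + 1 < σ) (hd₁ : 0 ≤ d₁)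
    (hd₂ : 0 ≤ d₂) (hd : d₁ + d₂ ≤ 1) :
    ∃ C : ℝ≥0, ∀ (F G : ℝ → ℂ) (P Q : ℕ → ℝ → ℂ) (M S : ℝ≥0) (s t : Set ℝ),
    DyadicDecomp (2 ^ (-σ)) (2 ^ d₁) F P M S → DyadicDecomp (2 ^ (-σ)) (2 ^ d₂) G Q M S →
    IsHalfLine s → IsHalfLine t →
    eLpNorm (fun ξ => (((1 + ξ ^ 2) ^ (γ / 2) * |ξ| ^ (1 - d₁ - d₂) : ℝ) : ℂ) *
      conv (s.indicator F) (t.indicator G) ξ) 2 ≤ (C * (M * S) : ℝ≥0) := by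
  obtain ⟨m, hm⟩ := exists_nat_gt (σ / (σ - γ - 1))
  have hm' : (0 : ℝ) < m + 2 := by positivity
  have hθ : σ * (1 / (m + 2)) < σ - γ - 1 := by
    rw [mul_one_div, div_lt_iff₀ hm']
    rw [div_lt_iff₀ (by linarith)] at hm
    nlinarith
  have h2 : (2 : ℝ≥0) ≠ 0 := two_ne_zero
  have hlt : ∀ d : ℝ, d ≤ 1 → (2 : ℝ≥0) ^ d * 2 ^ (-σ) < 1 := fun d h => by
    rw [← NNReal.rpow_add h2]
    exact NNReal.rpow_lt_one_of_one_lt_of_neg one_lt_two (by linarith)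
  obtain ⟨C, hC⟩ := exists_weight_conv_bound (q := 2 ^ (-σ)) (w₁ := 2 ^ d₁) (w₂ := 2 ^ d₂)
    (p := 2 ^ (γ + (1 - d₁ - d₂))) (2 ^ (5 * γ / 2 + 2 * (1 - d₁ - d₂))) (m := m)
    (θ := 1 / (m + 2)) (by field_simp) (NNReal.one_le_rpow one_le_two hd₁)
    (NNReal.one_le_rpow one_le_two hd₂) (hlt d₁ (by linarith)) (hlt d₂ (by linarith)) (by
      rw [← NNReal.rpow_mul, ← NNReal.rpow_add h2, ← NNReal.rpow_add h2, ← NNReal.rpow_add h2]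
      exact NNReal.rpow_lt_one_of_one_lt_of_neg one_lt_two (by linarith))
  refine ⟨C, fun F G P Q M S s t hF hG hs ht =>
    hC F G P Q M S s t _ hF hG hs ht (by fun_prop) fun n ξ hξ => ?_⟩
  rw [Complex.norm_real, Real.norm_of_nonneg (by positivity)]
  simpa using sobolevWeight_le hγ (by linarith) n hξ

theorem eLpNorm_le_of_ae_le_sum {ι E E' : Type*} [NormedAddCommGroup E]
    [NormedAddCommGroup E'] {I : Finset ι} {f : ℝ → E}
    {g : ι → ℝ → E'} {K B : ℝ≥0} (hg : ∀ i ∈ I, AEStronglyMeasurable (g i))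
    (h : ∀ᵐ x, ‖f x‖ ≤ K * ∑ i ∈ I, ‖g i x‖) (hB : ∀ i ∈ I, eLpNorm (g i) 2 ≤ B) :
    eLpNorm f 2 ≤ (K * (I.card * B) : ℝ≥0) := by
  refine (eLpNorm_le_nnreal_smul_eLpNorm_of_ae_le_mul (c := K) (g := ∑ i ∈ I, fun x => ‖g i x‖)
    (h.mono fun x hx => ?_) 2).trans ?_
  · rw [← NNReal.coe_le_coe]
    refine hx.trans ?_
    simp only [NNReal.coe_mul, coe_nnnorm, Finset.sum_apply]
    gcongr
    exact le_abs_self _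
  · rw [ENNReal.smul_def, smul_eq_mul, ENNReal.coe_mul]
    refine mul_le_mul_right ((eLpNorm_sum_le (fun i hi => (hg i hi).norm) (by norm_num)).trans
      ((Finset.sum_le_sum fun i hi => (eLpNorm_norm (g i)).trans_le (hB i hi)).trans ?_)) _
    simp

section Symbol

variable {μ ν ξ₁ ξ₂ : ℝ}

theorem msym₁_of_mul_pos (h : 0 < (ξ₁ + ξ₂) * ξ₂) : msym₁ ξ₁ ξ₂ = 0 := by
  rw [msym₁, ← abs_mul, abs_of_pos h, sub_self, zero_div]

theorem msym₂_of_mul_neg (h : ξ₁ * ξ₂ < 0) : msym₂ ξ₁ ξ₂ = 0 := by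
  rw [msym₂, ← abs_mul, abs_of_neg h, neg_add_cancel, mul_zero, zero_div]

theorem msym₁_eq_mul_PhiFn (hμ : μ ^ 2 = 1) (hν : ν ^ 2 = 1) (h : (ξ₁ + ξ₂) * ξ₂ < 0) :
    msym₁ ξ₁ ξ₂ = -(ν * √|ξ₁ + ξ₂| * (√|ξ₁ + ξ₂| + μ * √|ξ₁| - ν * √|ξ₂|)) * PhiFn μ ν ξ₁ ξ₂ ∧
      PhiFn μ ν ξ₁ ξ₂ ≠ 0 := by
  have hz : 0 < √|ξ₁ + ξ₂| := Real.sqrt_pos.2 (abs_pos.2 (left_ne_zero_of_mul h.ne))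
  have hy : 0 < √|ξ₂| := Real.sqrt_pos.2 (abs_pos.2 (right_ne_zero_of_mul h.ne))
  have hz2 := Real.sq_sqrt (abs_nonneg (ξ₁ + ξ₂))
  have hy2 := Real.sq_sqrt (abs_nonneg ξ₂)
  have hx2 : √|ξ₁| ^ 2 = √|ξ₁ + ξ₂| ^ 2 + √|ξ₂| ^ 2 := by
    rw [Real.sq_sqrt (abs_nonneg ξ₁), hz2, hy2]
    rcases mul_neg_iff.1 h with ⟨h1, h2⟩ | ⟨h1, h2⟩
    · rw [abs_of_pos h1, abs_of_neg h2, abs_of_pos (by linarith)]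
      ring
    · rw [abs_of_neg h1, abs_of_pos h2, abs_of_neg (by linarith)]
      ring
  have hprod : (√|ξ₁ + ξ₂| + μ * √|ξ₁| - ν * √|ξ₂|) * PhiFn μ ν ξ₁ ξ₂ =
      -(2 * ν * √|ξ₁ + ξ₂| * √|ξ₂|) := by
    rw [PhiFn]
    linear_combination (-μ ^ 2) * hx2 - (√|ξ₁ + ξ₂| ^ 2 + √|ξ₂| ^ 2) * hμ + √|ξ₂| ^ 2 * hν
  have hν0 : ν ≠ 0 := fun h0 => by simp [h0] at hν
  refine ⟨?_, fun h0 => ?_⟩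
  · rw [neg_mul, mul_assoc, hprod, msym₁, ← abs_mul, abs_of_neg h, div_eq_iff hy.ne']
    have h3 : -((ξ₁ + ξ₂) * ξ₂) = √|ξ₁ + ξ₂| ^ 2 * √|ξ₂| ^ 2 := by
      rw [hz2, hy2, ← abs_mul, abs_of_neg h]
    linear_combination 2 * h3 - 2 * √|ξ₁ + ξ₂| ^ 2 * √|ξ₂| ^ 2 * hν
  · rw [h0, mul_zero, eq_comm, neg_eq_zero] at hprod
    exact absurd hprod (by positivity)

theorem msym₂_eq_mul_PhiFn (hμ : μ ^ 2 = 1) (hν : ν ^ 2 = 1) (h : 0 < ξ₁ * ξ₂) :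
    msym₂ ξ₁ ξ₂ =
        -(μ * ν * √|ξ₁ + ξ₂| * (√|ξ₁ + ξ₂| + μ * √|ξ₁| + ν * √|ξ₂|)) * PhiFn μ ν ξ₁ ξ₂ ∧
      PhiFn μ ν ξ₁ ξ₂ ≠ 0 := by
  have hx : 0 < √|ξ₁| := Real.sqrt_pos.2 (abs_pos.2 (left_ne_zero_of_mul h.ne'))
  have hy : 0 < √|ξ₂| := Real.sqrt_pos.2 (abs_pos.2 (right_ne_zero_of_mul h.ne'))
  have hx2 := Real.sq_sqrt (abs_nonneg ξ₁)
  have hy2 := Real.sq_sqrt (abs_nonneg ξ₂)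
  have hz2 : √|ξ₁ + ξ₂| ^ 2 = √|ξ₁| ^ 2 + √|ξ₂| ^ 2 := by
    rw [Real.sq_sqrt (abs_nonneg _), hx2, hy2]
    rcases mul_pos_iff.1 h with ⟨h1, h2⟩ | ⟨h1, h2⟩
    · rw [abs_of_pos h1, abs_of_pos h2, abs_of_pos (by linarith)]
    · rw [abs_of_neg h1, abs_of_neg h2, abs_of_neg (by linarith)]
      ring
  have hprod : (√|ξ₁ + ξ₂| + μ * √|ξ₁| + ν * √|ξ₂|) * PhiFn μ ν ξ₁ ξ₂ =
      -(2 * μ * ν * √|ξ₁| * √|ξ₂|) := by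
    rw [PhiFn]
    linear_combination hz2 - √|ξ₁| ^ 2 * hμ - √|ξ₂| ^ 2 * hν
  have hμ0 : μ ≠ 0 := fun h0 => by simp [h0] at hμ
  have hν0 : ν ≠ 0 := fun h0 => by simp [h0] at hν
  refine ⟨?_, fun h0 => ?_⟩
  · rw [neg_mul, mul_assoc, hprod, msym₂, Real.sqrt_mul (abs_nonneg _),
      div_eq_iff (mul_pos hx hy).ne', ← abs_mul, abs_of_pos h]
    have h3 : ξ₁ * ξ₂ = √|ξ₁| ^ 2 * √|ξ₂| ^ 2 := by rw [hx2, hy2, ← abs_mul, abs_of_pos h]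
    linear_combination 2 * √|ξ₁ + ξ₂| * h3 -
      2 * √|ξ₁ + ξ₂| * √|ξ₁| ^ 2 * √|ξ₂| ^ 2 * (ν ^ 2 * hμ + hν)
  · rw [h0, mul_zero, eq_comm, neg_eq_zero] at hprod
    exact absurd hprod (by positivity)

theorem msym_div_PhiFn (hμ : μ ^ 2 = 1) (hν : ν ^ 2 = 1) (a b : ℂ) (h₁ : ξ₁ ≠ 0) (h₂ : ξ₂ ≠ 0)
    (h : ξ₁ + ξ₂ ≠ 0) :
    msym a b ξ₁ ξ₂ / (I * (PhiFn μ ν ξ₁ ξ₂ : ℂ)) =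
      (if (ξ₁ + ξ₂) * ξ₂ < 0 then
        I * a * ν * √|ξ₁ + ξ₂| * (√|ξ₁ + ξ₂| + μ * √|ξ₁| - ν * √|ξ₂| : ℂ) else 0) +
      (if 0 < ξ₁ * ξ₂ then
        I * b * μ * ν * √|ξ₁ + ξ₂| * (√|ξ₁ + ξ₂| + μ * √|ξ₁| + ν * √|ξ₂| : ℂ) else 0) := by
  have hI : ∀ (c d : ℂ), d ≠ 0 → c * d / (I * d) = -(I * c) := fun c d hd => by
    rw [mul_div_mul_right _ _ hd, div_I, mul_comm]
  rcases lt_or_gt_of_ne (mul_ne_zero h h₂) with h3 | h3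
  · have h4 : ξ₁ * ξ₂ < 0 := by nlinarith [sq_nonneg ξ₂]
    obtain ⟨e, hne⟩ := msym₁_eq_mul_PhiFn hμ hν h3
    rw [if_pos h3, if_neg h4.not_gt, msym, msym₂_of_mul_neg h4, e]
    push_cast
    rw [mul_zero, add_zero, add_zero, ← mul_assoc, hI _ _ (ofReal_ne_zero.2 hne)]
    ring
  · rw [if_neg h3.not_gt, msym, msym₁_of_mul_pos h3]
    rcases lt_or_gt_of_ne (mul_ne_zero h₁ h₂) with h4 | h4
    · rw [if_neg h4.not_gt, msym₂_of_mul_neg h4]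
      simp
    · obtain ⟨e, hne⟩ := msym₂_eq_mul_PhiFn hμ hν h4
      rw [if_pos h4, e]
      push_cast
      rw [mul_zero, zero_add, zero_add, ← mul_assoc, hI _ _ (ofReal_ne_zero.2 hne)]
      ring

end Symbol

/-- The Fourier side of `Qop`, acting on the Fourier transforms of the two arguments. -/
def symbolConv (μ ν : ℝ) (m : ℝ → ℝ → ℂ) (F G : ℝ → ℂ) (ξ : ℝ) : ℂ :=
  ∫ ξ₁ : ℝ, m ξ₁ (ξ - ξ₁) / (I * (PhiFn μ ν ξ₁ (ξ - ξ₁) : ℂ)) * F ξ₁ * G (ξ - ξ₁)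

/-- Multiplication by `√|ξ|`. -/
def sqrtAbsMul (F : ℝ → ℂ) (ξ : ℝ) : ℂ := (√|ξ| : ℂ) * F ξ

section

variable {μ ν : ℝ} {F G : ℝ → ℂ} {H H' : Set ℝ} {ξ : ℝ}

theorem symbolConv_integrand (hμ : μ ^ 2 = 1) (hν : ν ^ 2 = 1) (a b : ℂ) (hξ : ξ ≠ 0)
    (hH : ∀ x, x ∈ H ↔ 0 < ξ * x) (hH' : ∀ x, x ∈ H' ↔ ξ * x < 0) {t : ℝ} (h₁ : t ≠ 0)
    (h₂ : ξ - t ≠ 0) :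
    msym a b t (ξ - t) / (I * (PhiFn μ ν t (ξ - t) : ℂ)) * F t * G (ξ - t) =
      I * a * ν * √|ξ| * (√|ξ| * (H.indicator F t * H'.indicator G (ξ - t)) +
        μ * (H.indicator (sqrtAbsMul F) t * H'.indicator G (ξ - t)) -
        ν * (H.indicator F t * H'.indicator (sqrtAbsMul G) (ξ - t))) +
      I * b * μ * ν * √|ξ| * (√|ξ| * (H.indicator F t * H.indicator G (ξ - t)) +
        μ * (H.indicator (sqrtAbsMul F) t * H.indicator G (ξ - t)) +
        ν * (H.indicator F t * H.indicator (sqrtAbsMul G) (ξ - t))) := by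
  classical
  have hsq : 0 < ξ * t + ξ * (ξ - t) := by
    rw [← mul_add, add_sub_cancel]
    exact mul_self_pos.2 hξ
  have hpos : 0 < t * (ξ - t) ↔ 0 < ξ * t ∧ 0 < ξ * (ξ - t) := by
    have e : ξ * t * (ξ * (ξ - t)) = ξ ^ 2 * (t * (ξ - t)) := by ring
    rw [← mul_pos_iff_of_pos_left (pow_pos (abs_pos.2 hξ) 2), sq_abs, ← e, mul_pos_iff]
    exact or_iff_left fun h => by linarith [h.1, h.2]
  rw [msym_div_PhiFn hμ hν a b h₁ h₂ (by rwa [add_sub_cancel])]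
  simp only [add_sub_cancel, hpos, Set.indicator_apply, hH, hH', sqrtAbsMul]
  rcases lt_or_gt_of_ne (mul_ne_zero hξ h₂) with h3 | h3
  · have h4 : 0 < ξ * t := by linarith
    simp only [h3, h4, h3.not_gt, if_true, if_false, and_false]
    ring
  · simp only [h3, h3.not_gt, if_false, and_true, mul_zero, add_zero, sub_zero, zero_add]
    split_ifs <;> ring

theorem symbolConv_eq (hμ : μ ^ 2 = 1) (hν : ν ^ 2 = 1) (a b : ℂ) (hF : MemLp F 2)
    (hG : MemLp G 2) (hF' : MemLp (sqrtAbsMul F) 2) (hG' : MemLp (sqrtAbsMul G) 2)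
    (hHm : MeasurableSet H) (hHm' : MeasurableSet H') (hξ : ξ ≠ 0)
    (hH : ∀ x, x ∈ H ↔ 0 < ξ * x) (hH' : ∀ x, x ∈ H' ↔ ξ * x < 0) :
    symbolConv μ ν (msym a b) F G ξ =
      I * a * ν * √|ξ| * (√|ξ| * conv (H.indicator F) (H'.indicator G) ξ +
        μ * conv (H.indicator (sqrtAbsMul F)) (H'.indicator G) ξ -
        ν * conv (H.indicator F) (H'.indicator (sqrtAbsMul G)) ξ) +
      I * b * μ * ν * √|ξ| * (√|ξ| * conv (H.indicator F) (H.indicator G) ξ +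
        μ * conv (H.indicator (sqrtAbsMul F)) (H.indicator G) ξ +
        ν * conv (H.indicator F) (H.indicator (sqrtAbsMul G)) ξ) := by
  have hint : ∀ {V W : ℝ → ℂ} {s t : Set ℝ}, MemLp V 2 → MemLp W 2 → MeasurableSet s →
      MeasurableSet t → Integrable fun x => s.indicator V x * t.indicator W (ξ - x) :=
    fun hV hW hs ht => integrable_mul_sub (hV.indicator hs) (hW.indicator ht) ξ
  have i1 := hint hF hG hHm hHm'
  have i2 := hint hF' hG hHm hHm'
  have i3 := hint hF hG' hHm hHm'
  have i4 := hint hF hG hHm hHm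
  have i5 := hint hF' hG hHm hHm
  have i6 := hint hF hG' hHm hHm
  have hae : ∀ᵐ t : ℝ, t ≠ 0 ∧ ξ - t ≠ 0 := by
    filter_upwards [compl_mem_ae_iff.2 (measure_singleton (0 : ℝ)),
      compl_mem_ae_iff.2 (measure_singleton ξ)] with t h1 h2
    exact ⟨h1, sub_ne_zero.2 (Ne.symm h2)⟩
  rw [symbolConv, integral_congr_ae (hae.mono fun t ht =>
    symbolConv_integrand (F := F) (G := G) hμ hν a b hξ hH hH' ht.1 ht.2)]
  rw [integral_add, integral_const_mul, integral_const_mul, integral_sub, integral_add,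
    integral_add, integral_add]
  · simp only [integral_const_mul, conv_apply]
  all_goals fun_prop

/-- The absolute-value majorant of the part of `symbolConv` in which the two frequencies are
restricted to `s` and `t`. -/
def halfLineMajorant (F G : ℝ → ℂ) (s t : Set ℝ) (ξ : ℝ) : ℝ :=
  |ξ| * ‖conv (s.indicator F) (t.indicator G) ξ‖ +
    √|ξ| * ‖conv (s.indicator (sqrtAbsMul F)) (t.indicator G) ξ‖ +
    √|ξ| * ‖conv (s.indicator F) (t.indicator (sqrtAbsMul G)) ξ‖

theorem halfLineMajorant_nonneg (F G : ℝ → ℂ) (s t : Set ℝ) (ξ : ℝ) :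
    0 ≤ halfLineMajorant F G s t ξ := by
  unfold halfLineMajorant
  positivity

theorem norm_symbolConv_le (hμ : μ ^ 2 = 1) (hν : ν ^ 2 = 1) (a b : ℂ) (hF : MemLp F 2)
    (hG : MemLp G 2) (hF' : MemLp (sqrtAbsMul F) 2) (hG' : MemLp (sqrtAbsMul G) 2)
    (hHm : MeasurableSet H) (hHm' : MeasurableSet H') (hξ : ξ ≠ 0)
    (hH : ∀ x, x ∈ H ↔ 0 < ξ * x) (hH' : ∀ x, x ∈ H' ↔ ξ * x < 0) :
    ‖symbolConv μ ν (msym a b) F G ξ‖ ≤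
      ‖a‖ * halfLineMajorant F G H H' ξ + ‖b‖ * halfLineMajorant F G H H ξ := by
  have hone : ∀ {x : ℝ}, x ^ 2 = 1 → ‖(x : ℂ)‖ = 1 := fun {x} hx =>
    (pow_eq_one_iff_of_nonneg (norm_nonneg _) two_ne_zero).1 (by
      rw [← norm_pow, ← ofReal_pow, hx, ofReal_one, norm_one])
  have hμ' := hone hμ
  have hν' := hone hν
  have hz : ‖(√|ξ| : ℂ)‖ = √|ξ| := by
    rw [Complex.norm_real, Real.norm_of_nonneg (Real.sqrt_nonneg _)]
  have hzz : |ξ| = √|ξ| * √|ξ| := (Real.mul_self_sqrt (abs_nonneg ξ)).symm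
  have key : ∀ (u v w : ℂ), √|ξ| * (‖(√|ξ| * u + μ * v : ℂ)‖ + ‖(ν * w : ℂ)‖) ≤
      |ξ| * ‖u‖ + √|ξ| * ‖v‖ + √|ξ| * ‖w‖ := fun u v w => by
    have := norm_add_le (√|ξ| * u : ℂ) (μ * v)
    rw [norm_mul, norm_mul, hμ', hz, one_mul] at this
    rw [norm_mul, hν', one_mul]
    linear_combination √|ξ| * this - ‖u‖ * hzz
  rw [symbolConv_eq hμ hν a b hF hG hF' hG' hHm hHm' hξ hH hH']
  refine (norm_add_le _ _).trans (add_le_add ?_ ?_)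
  · rw [norm_mul, norm_mul, norm_mul, norm_mul, norm_I, hν', hz, one_mul, mul_one, mul_assoc]
    refine mul_le_mul_of_nonneg_left (le_trans ?_ (key _ _ _)) (norm_nonneg _)
    gcongr
    exact norm_sub_le _ _
  · rw [norm_mul, norm_mul, norm_mul, norm_mul, norm_mul, norm_I, hμ', hν', hz, one_mul, mul_one,
      mul_one, mul_assoc]
    refine mul_le_mul_of_nonneg_left (le_trans ?_ (key _ _ _)) (norm_nonneg _)
    gcongr
    exact norm_add_le _ _

end

theorem two_rpow_neg_lt_one {σ : ℝ} (hσ : 1 < σ) : 1 * (2 : ℝ≥0) ^ (-σ) < 1 := by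
  rw [one_mul]
  exact NNReal.rpow_lt_one_of_one_lt_of_neg one_lt_two (by linarith)

theorem sqrt_two_mul_two_rpow_neg_lt_one {σ : ℝ} (hσ : 1 < σ) :
    NNReal.sqrt 2 * (2 : ℝ≥0) ^ (-σ) < 1 := by
  rw [NNReal.sqrt_eq_rpow, ← NNReal.rpow_add two_ne_zero]
  exact NNReal.rpow_lt_one_of_one_lt_of_neg one_lt_two (by linarith)

theorem exists_halfLineMajorant_bound {σ γ : ℝ} (hγ : 0 < γ) (hσ : γ + 1 < σ) :
    ∃ C : ℝ≥0, ∀ (F G : ℝ → ℂ) (P P' Q Q' : ℕ → ℝ → ℂ) (M S : ℝ≥0) (s t : Set ℝ),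
    DyadicDecomp (2 ^ (-σ)) 1 F P M S →
    DyadicDecomp (2 ^ (-σ)) (NNReal.sqrt 2) (sqrtAbsMul F) P' M S →
    DyadicDecomp (2 ^ (-σ)) 1 G Q M S →
    DyadicDecomp (2 ^ (-σ)) (NNReal.sqrt 2) (sqrtAbsMul G) Q' M S →
    IsHalfLine s → IsHalfLine t →
    AEStronglyMeasurable (fun ξ => (1 + ξ ^ 2) ^ (γ / 2) * halfLineMajorant F G s t ξ) ∧
    eLpNorm (fun ξ => (1 + ξ ^ 2) ^ (γ / 2) * halfLineMajorant F G s t ξ) 2 ≤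
      (C * (M * S) : ℝ≥0) := by
  obtain ⟨C₁, h₁⟩ := exists_sobolev_conv_bound (d₁ := 0) (d₂ := 0) hγ.le hσ le_rfl le_rfl
    (by norm_num)
  obtain ⟨C₂, h₂⟩ := exists_sobolev_conv_bound (d₁ := 1 / 2) (d₂ := 0) hγ.le hσ (by norm_num)
    le_rfl (by norm_num)
  obtain ⟨C₃, h₃⟩ := exists_sobolev_conv_bound (d₁ := 0) (d₂ := 1 / 2) hγ.le hσ le_rfl
    (by norm_num) (by norm_num)
  simp only [NNReal.rpow_zero, ← NNReal.sqrt_eq_rpow, sub_zero,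
    show (1 : ℝ) - 1 / 2 = 1 / 2 by norm_num, Real.rpow_one, ← Real.sqrt_eq_rpow] at h₁ h₂ h₃
  have q₁ := two_rpow_neg_lt_one (by linarith : 1 < σ)
  have q₂ := sqrt_two_mul_two_rpow_neg_lt_one (by linarith : 1 < σ)
  refine ⟨C₁ + C₂ + C₃, fun F G P P' Q Q' M S s t hF hF' hG hG' hs ht => ?_⟩
  have w₁ : Measurable fun ξ : ℝ => (((1 + ξ ^ 2) ^ (γ / 2) * |ξ| : ℝ) : ℂ) := by fun_prop
  have w₂ : Measurable fun ξ : ℝ => (((1 + ξ ^ 2) ^ (γ / 2) * √|ξ| : ℝ) : ℂ) := by fun_prop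
  have m₁ := (w₁.aestronglyMeasurable.mul
    (hF.aestronglyMeasurable_conv q₁ q₁ hG hs.measurableSet ht.measurableSet)).norm
  have m₂ := (w₂.aestronglyMeasurable.mul
    (hF'.aestronglyMeasurable_conv q₂ q₁ hG hs.measurableSet ht.measurableSet)).norm
  have m₃ := (w₂.aestronglyMeasurable.mul
    (hF.aestronglyMeasurable_conv q₁ q₂ hG' hs.measurableSet ht.measurableSet)).norm
  have b₁ := (eLpNorm_norm _).trans_le (h₁ F G P Q M S s t hF hG hs ht)
  have b₂ := (eLpNorm_norm _).trans_le (h₂ _ G P' Q M S s t hF' hG hs ht)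
  have b₃ := (eLpNorm_norm _).trans_le (h₃ F _ P Q' M S s t hF hG' hs ht)
  have e : (fun ξ => (1 + ξ ^ 2) ^ (γ / 2) * halfLineMajorant F G s t ξ) =
      (fun ξ => ‖(((1 + ξ ^ 2) ^ (γ / 2) * |ξ| : ℝ) : ℂ) *
        conv (s.indicator F) (t.indicator G) ξ‖) +
      (fun ξ => ‖(((1 + ξ ^ 2) ^ (γ / 2) * √|ξ| : ℝ) : ℂ) *
        conv (s.indicator (sqrtAbsMul F)) (t.indicator G) ξ‖) +
      fun ξ => ‖(((1 + ξ ^ 2) ^ (γ / 2) * √|ξ| : ℝ) : ℂ) *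
        conv (s.indicator F) (t.indicator (sqrtAbsMul G)) ξ‖ := by
    funext ξ
    have h0 : 0 ≤ (1 + ξ ^ 2) ^ (γ / 2) := by positivity
    simp only [Pi.add_apply, norm_mul, Complex.norm_real, Real.norm_eq_abs,
      abs_of_nonneg h0, abs_abs, abs_of_nonneg (Real.sqrt_nonneg |ξ|), halfLineMajorant]
    ring
  rw [e]
  refine ⟨(m₁.add m₂).add m₃, ?_⟩
  refine (eLpNorm_add_le (m₁.add m₂) m₃ one_le_two).trans ?_
  rw [add_mul, add_mul, ENNReal.coe_add, ENNReal.coe_add]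
  exact add_le_add ((eLpNorm_add_le m₁ m₂ one_le_two).trans (add_le_add b₁ b₂)) b₃

theorem exists_symbolConv_bound {σ γ μ ν : ℝ} (hγ : 0 < γ) (hσ : γ + 1 < σ) (hμ : μ ^ 2 = 1)
    (hν : ν ^ 2 = 1) (a b : ℂ) :
    ∃ C : ℝ≥0, ∀ (F G : ℝ → ℂ) (P P' Q Q' : ℕ → ℝ → ℂ) (M S : ℝ≥0),
    DyadicDecomp (2 ^ (-σ)) 1 F P M S →
    DyadicDecomp (2 ^ (-σ)) (NNReal.sqrt 2) (sqrtAbsMul F) P' M S →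
    DyadicDecomp (2 ^ (-σ)) 1 G Q M S →
    DyadicDecomp (2 ^ (-σ)) (NNReal.sqrt 2) (sqrtAbsMul G) Q' M S →
    eLpNorm (fun ξ => (((1 + ξ ^ 2) ^ (γ / 2) : ℝ) : ℂ) * symbolConv μ ν (msym a b) F G ξ) 2 ≤
      (C * (M * S) : ℝ≥0) := by
  obtain ⟨C, hC⟩ := exists_halfLineMajorant_bound hγ hσ
  have q₁ := two_rpow_neg_lt_one (by linarith : 1 < σ)
  have q₂ := sqrt_two_mul_two_rpow_neg_lt_one (by linarith : 1 < σ)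
  refine ⟨(‖a‖₊ + ‖b‖₊) * (4 * C), fun F G P P' Q Q' M S hF hF' hG hG' => ?_⟩
  set J : Bool → Set ℝ := fun i => cond i (Set.Ioi 0) (Set.Iio 0)
  have hJ : ∀ i, IsHalfLine (J i) := by
    rintro (_ | _)
    exacts [isHalfLine_Iio, isHalfLine_Ioi]
  have hJC := fun i : Bool × Bool =>
    hC F G P P' Q Q' M S (J i.1) (J i.2) hF hF' hG hG' (hJ _) (hJ _)
  refine (eLpNorm_le_of_ae_le_sum (I := Finset.univ) (K := ‖a‖₊ + ‖b‖₊) (B := C * (M * S))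
    (g := fun (i : Bool × Bool) ξ => (1 + ξ ^ 2) ^ (γ / 2) * halfLineMajorant F G (J i.1) (J i.2) ξ)
    (fun i _ => (hJC i).1) ?_ (fun i _ => (hJC i).2)).trans (le_of_eq ?_)
  · filter_upwards [compl_mem_ae_iff.2 (measure_singleton (0 : ℝ))] with ξ hξ
    have h0 : 0 ≤ (1 + ξ ^ 2) ^ (γ / 2) := by positivity
    have hN := fun i j => halfLineMajorant_nonneg F G (J i) (J j) ξ
    have key : ∃ i : Bool, ‖symbolConv μ ν (msym a b) F G ξ‖ ≤
        ‖a‖ * halfLineMajorant F G (J i) (J !i) ξ + ‖b‖ * halfLineMajorant F G (J i) (J i) ξ := by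
      have := fun i => norm_symbolConv_le (ξ := ξ) hμ hν a b (hF.memLp q₁) (hG.memLp q₁)
        (hF'.memLp q₂) (hG'.memLp q₂) (hJ i).measurableSet (hJ !i).measurableSet hξ
      rcases lt_or_gt_of_ne (show ξ ≠ 0 from hξ) with h | h
      · exact ⟨false, this _ (fun x => by simp [J, mul_pos_iff, h, h.not_gt])
          fun x => by simp [J, mul_neg_iff, h, h.not_gt]⟩
      · exact ⟨true, this _ (fun x => by simp [J, h])
          fun x => by simp [J, mul_neg_iff, h, h.not_gt]⟩
    obtain ⟨i, hi⟩ := key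
    have hsum : ∀ p : Bool × Bool, halfLineMajorant F G (J p.1) (J p.2) ξ ≤
        ∑ p : Bool × Bool, halfLineMajorant F G (J p.1) (J p.2) ξ := fun p =>
      Finset.single_le_sum (f := fun p : Bool × Bool => halfLineMajorant F G (J p.1) (J p.2) ξ)
        (fun p _ => hN p.1 p.2) (Finset.mem_univ p)
    simp only [norm_mul, Complex.norm_real, Real.norm_eq_abs, abs_of_nonneg h0,
      abs_of_nonneg (hN _ _), ← Finset.mul_sum, NNReal.coe_add, coe_nnnorm]
    rw [mul_left_comm]
    refine mul_le_mul_of_nonneg_left (hi.trans ?_) h0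
    rw [add_mul]
    gcongr
    exacts [hsum (i, !i), hsum (i, i)]
  · simp [mul_assoc]

theorem fourier_eq_zero_of_not_integrable {u : ℝ → ℂ} (hu : ¬Integrable u) : 𝓕 u = 0 := by
  funext ξ
  rw [Real.fourier_eq]
  exact integral_undef fun h => hu ((Real.fourierIntegral_convergent_iff ξ).1 h)

theorem HNorm_fourierInv_le (γ : ℝ) (W : ℝ → ℂ) :
    HNorm γ (𝓕⁻ W) ≤ eLpNorm (fun ξ => (((1 + ξ ^ 2) ^ (γ / 2) : ℝ) : ℂ) * W ξ) 2 := by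
  have hzero : ∀ {v : ℝ → ℂ}, 𝓕 v = 0 → HNorm γ v = 0 := fun {v} hv => by
    simp [HNorm_eq, hv]
  by_cases h2 : Integrable (𝓕⁻ W)
  · by_cases h1 : Integrable W
    · rw [HNorm_eq]
      exact (eLpNorm_congr_ae ((fourier_fourierInv_ae h1 h2).mono fun ξ h => by
        simp only [h])).le
    · have h3 : 𝓕⁻ W = 0 := by
        funext x
        rw [Real.fourierInv_eq_fourier_neg, fourier_eq_zero_of_not_integrable h1]
        rfl
      rw [h3, hzero]
      · exact zero_le
      · funext ξ
        simp [Real.fourier_eq]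
  · rw [hzero (fourier_eq_zero_of_not_integrable h2)]
    exact zero_le

theorem LPFamily.exists_dyadic_pick (χ : LPFamily) {s ρ : ℝ} (hs : 1 / 2 < s) (hρ : 0 ≤ ρ) :
    ∃ c₁ c₂ : ℝ≥0, ∀ (u : ℝ → ℂ) (B S : ℝ≥0) (μ : ℝ), Integrable u → HNorm s u = S →
      BesovNorm χ.χ ρ u = B → ∃ P P' : ℕ → ℝ → ℂ,
      DyadicDecomp (2 ^ (-s)) 1 (𝓕 (pick μ u)) P (c₁ * B) (c₂ * S) ∧
      DyadicDecomp (2 ^ (-s)) (NNReal.sqrt 2) (sqrtAbsMul (𝓕 (pick μ u))) P' (c₁ * B)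
        (c₂ * S) := by
  obtain ⟨c, hc⟩ := χ.exists_dyadic hs hρ
  obtain ⟨C, hC1, hC⟩ := χ.exists_dyadic_sqrt
  refine ⟨C, C * c, fun u B S μ hu hS hB => ?_⟩
  obtain ⟨P, hP⟩ : ∃ P, DyadicDecomp (2 ^ (-s)) 1 (𝓕 (pick μ u)) P B (c * S) := by
    have h := hc u B S hu hS hB
    by_cases hμ : μ = 1
    · rw [pick, if_pos hμ]
      exact ⟨_, h⟩
    · rw [pick, if_neg hμ, show 𝓕 (fun x => starRingEnd ℂ (u x)) = _ from funext (fourier_conj u)]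
      exact ⟨_, h.conj_neg⟩
  rw [mul_assoc]
  exact ⟨P, _, hP.mono (le_mul_of_one_le_left zero_le hC1) (le_mul_of_one_le_left zero_le hC1),
    hC _ _ _ _ _ hP⟩

/-- Sobolev bound for the normal form boundary term `Q_{μν}`. -/
theorem Q_Sobolev_bound (s γ ρ : ℝ) (h1 : s > γ + 1) (h2 : γ + 1 = ρ + 3/2)
    (h3 : ρ + 3/2 > 3/2) (μ ν : ℝ) (hμ : μ = 1 ∨ μ = -1) (hν : ν = 1 ∨ ν = -1)
    (a b : ℂ) (χ : LPFamily) :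
    ∃ C : ℝ, 0 < C ∧
      ∀ u : ℝ → ℂ, HNorm s u < ⊤ → BesovNorm χ.χ ρ u < ⊤ →
        HNorm γ (Qop μ ν (msym a b) (pick μ u) (pick ν u))
          ≤ ENNReal.ofReal C * BesovNorm χ.χ ρ u * HNorm s u := by
  obtain ⟨c₁, c₂, hc⟩ := χ.exists_dyadic_pick (s := s) (ρ := ρ) (by linarith) (by linarith)
  obtain ⟨K, hK⟩ := exists_symbolConv_bound (γ := γ) (by linarith) h1 (sq_eq_one_iff.2 hμ)
    (sq_eq_one_iff.2 hν) a b
  refine ⟨(K * (c₁ * c₂) + 1 : ℝ≥0), by positivity, fun u hS hB => ?_⟩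
  refine (HNorm_fourierInv_le γ (symbolConv μ ν (msym a b) (𝓕 (pick μ u)) (𝓕 (pick ν u)))).trans ?_
  by_cases hu : Integrable u
  · obtain ⟨P, P', hP, hP'⟩ := hc u _ _ μ hu (ENNReal.coe_toNNReal hS.ne).symm
      (ENNReal.coe_toNNReal hB.ne).symm
    obtain ⟨Q, Q', hQ, hQ'⟩ := hc u _ _ ν hu (ENNReal.coe_toNNReal hS.ne).symm
      (ENNReal.coe_toNNReal hB.ne).symm
    refine (hK _ _ P P' Q Q' _ _ hP hP' hQ hQ').trans ?_
    rw [ENNReal.ofReal_coe_nnreal, ← ENNReal.coe_toNNReal hS.ne, ← ENNReal.coe_toNNReal hB.ne,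
      ← ENNReal.coe_mul, ← ENNReal.coe_mul, ENNReal.coe_le_coe]
    simp only [ENNReal.toNNReal_coe]
    calc _ = K * (c₁ * c₂) * (BesovNorm χ.χ ρ u).toNNReal * (HNorm s u).toNNReal := by ring
      _ ≤ _ := by
        gcongr
        exact le_self_add
  · have h0 : 𝓕 (pick ν u) = 0 := by
      rw [pick]
      split_ifs
      · exact fourier_eq_zero_of_not_integrable hu
      · funext ξ
        rw [fourier_conj, fourier_eq_zero_of_not_integrable hu]
        simp
    have h4 : symbolConv μ ν (msym a b) (𝓕 (pick μ u)) (𝓕 (pick ν u)) = 0 := by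
      funext ξ
      simp [symbolConv, h0]
    simp [h4]

end
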